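/- arXiv:1410.3079 — 6 statements merged into one kernel-verified Lean document; each statement's English description precedes it below -/
import Mathlib

section
/- Let A → B be a non-expansive homomorphism of seminormed commutative rings and let φ : B → C be a surjective non-expansive homomorphism of seminormed rings with kernel J. In the second fundamental exact sequence J/J² → Ω_{B/A} ⊗_B C →(g) Ω_{C/A} → 0 all maps are non-expansive, where J carries the seminorm restricted from B, J/J² the corresponding quotient seminorm, Ω_{B/A} ⊗_B C the tensor seminorm, and Ω_{C/A} the Kähler seminorm. Moreover, if φ : B → C is strictly admissible (the quotient seminorm on C induced from B equals the given seminorm of C), then g is strictly admissible. -/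
open scoped NNReal TensorProduct

/-- A (nonarchimedean) seminorm on an additive group. -/
def IsGroupSeminorm {M : Type*} [AddCommGroup M] (f : M → ℝ≥0) : Prop :=
  f 0 = 0 ∧ ∀ x y : M, f (x - y) ≤ max (f x) (f y)

/-- A seminorm on a commutative ring. -/
def IsRingSeminorm {A : Type*} [CommRing A] (f : A → ℝ≥0) : Prop :=
  IsGroupSeminorm f ∧ f 1 = 1 ∧ ∀ x y : A, f (x * y) ≤ f x * f y

/-- The Kähler seminorm on `Ω[B⁄A]` induced by a seminorm `vB` on `B`. -/
noncomputable def kahlerSeminorm (A B : Type*) [CommRing A] [CommRing B] [Algebra A B]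
    (vB : B → ℝ≥0) (x : Ω[B⁄A]) : ℝ≥0 :=
  sInf { r | ∃ (n : ℕ) (c b : Fin n → B),
    x = ∑ i, c i • KaehlerDifferential.D A B (b i) ∧
    r = Finset.univ.sup fun i => vB (c i) * vB (b i) }

/-- The tensor seminorm on `M ⊗[A] N`. -/
noncomputable def tensorSeminorm (A M N : Type*) [CommRing A] [AddCommGroup M] [Module A M]
    [AddCommGroup N] [Module A N] (vM : M → ℝ≥0) (vN : N → ℝ≥0)
    (x : TensorProduct A M N) : ℝ≥0 :=
  sInf { r | ∃ (n : ℕ) (m : Fin n → M) (w : Fin n → N),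
    x = ∑ i, m i ⊗ₜ[A] w i ∧
    r = Finset.univ.sup fun i => vM (m i) * vN (w i) }

/-- The quotient seminorm induced by a (surjective) map `f : M → N` from a seminorm on `M`. -/
noncomputable def quotientSeminorm {M N : Type*} (f : M → N) (v : M → ℝ≥0) (y : N) : ℝ≥0 :=
  sInf { r | ∃ x : M, f x = y ∧ r = v x }

theorem aux_exists_mul_lt {S : Set ℝ≥0} (hS : S.Nonempty) {c t : ℝ≥0} (h : c * sInf S < t) :
    ∃ s ∈ S, c * s < t := by
  rcases eq_or_ne c 0 with rfl | hc
  · obtain ⟨s, hs⟩ := hS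
    exact ⟨s, hs, by simpa using h⟩
  · have hc' : 0 < c := pos_iff_ne_zero.2 hc
    have h1 : sInf S < t / c := by
      rw [lt_div_iff₀ hc', mul_comm]; exact h
    obtain ⟨s, hs, hlt⟩ := exists_lt_of_csInf_lt hS h1
    refine ⟨s, hs, ?_⟩
    rw [lt_div_iff₀ hc', mul_comm] at hlt
    exact hlt

theorem aux_le_mul_sInf {S : Set ℝ≥0} (hS : S.Nonempty) {c k : ℝ≥0}
    (h : ∀ s ∈ S, k ≤ c * s) : k ≤ c * sInf S := by
  by_contra! hlt
  obtain ⟨s, hs, h'⟩ := aux_exists_mul_lt hS hlt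
  exact absurd (h s hs) (not_le.2 h')

section
variable {A B : Type*} [CommRing A] [CommRing B] [Algebra A B]

theorem aux_kahler_le (v : B → ℝ≥0) {n : ℕ} (c b : Fin n → B) :
    kahlerSeminorm A B v (∑ i, c i • KaehlerDifferential.D A B (b i)) ≤
      Finset.univ.sup fun i => v (c i) * v (b i) :=
  csInf_le (OrderBot.bddBelow _) ⟨n, c, b, rfl, rfl⟩

theorem aux_kahler_smul_D_le (v : B → ℝ≥0) (c b : B) :
    kahlerSeminorm A B v (c • KaehlerDifferential.D A B b) ≤ v c * v b := by
  simpa using aux_kahler_le (A := A) v (n := 1) (fun _ => c) (fun _ => b)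

theorem aux_kahler_rep (x : Ω[B⁄A]) : ∃ (n : ℕ) (c b : Fin n → B),
    x = ∑ i, c i • KaehlerDifferential.D A B (b i) := by
  have hx : x ∈ Submodule.span B (Set.range (KaehlerDifferential.D A B)) := by
    rw [KaehlerDifferential.span_range_derivation]; trivial
  induction hx using Submodule.span_induction with
  | mem x h =>
    obtain ⟨b, rfl⟩ := h
    exact ⟨1, fun _ => 1, fun _ => b, by simp⟩
  | zero => exact ⟨0, fun _ => 0, fun _ => 0, by simp⟩
  | add x y _ _ hx hy =>
    obtain ⟨n, c, b, rfl⟩ := hx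
    obtain ⟨m, c', b', rfl⟩ := hy
    exact ⟨n + m, Fin.append c c', Fin.append b b', by simp [Fin.sum_univ_add]⟩
  | smul a x _ hx =>
    obtain ⟨n, c, b, rfl⟩ := hx
    exact ⟨n, fun i => a * c i, b, by simp [Finset.smul_sum, mul_smul]⟩

theorem aux_kahler_nonempty (v : B → ℝ≥0) (x : Ω[B⁄A]) :
    { r | ∃ (n : ℕ) (c b : Fin n → B),
    x = ∑ i, c i • KaehlerDifferential.D A B (b i) ∧
    r = Finset.univ.sup fun i => v (c i) * v (b i) }.Nonempty := by
  obtain ⟨n, c, b, h⟩ := aux_kahler_rep x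
  exact ⟨_, n, c, b, h, rfl⟩

theorem aux_kahler_zero (v : B → ℝ≥0) : kahlerSeminorm A B v 0 = 0 := by
  have := aux_kahler_le (A := A) v (n := 0) (fun _ => 0) (fun _ => 0)
  simpa using this

theorem aux_kahler_add (v : B → ℝ≥0) (x y : Ω[B⁄A]) :
    kahlerSeminorm A B v (x + y) ≤ max (kahlerSeminorm A B v x) (kahlerSeminorm A B v y) := by
  refine le_of_forall_gt_imp_ge_of_dense fun t ht => ?_
  obtain ⟨h1, h2⟩ := max_lt_iff.1 ht
  obtain ⟨_, ⟨n, c, b, hx, rfl⟩, hr⟩ := exists_lt_of_csInf_lt (aux_kahler_nonempty v x) h1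
  obtain ⟨_, ⟨m, c', b', hy, rfl⟩, hr'⟩ := exists_lt_of_csInf_lt (aux_kahler_nonempty v y) h2
  have e : x + y = ∑ i, Fin.append c c' i • KaehlerDifferential.D A B (Fin.append b b' i) := by
    rw [hx, hy]; simp [Fin.sum_univ_add]
  rw [e]
  refine (aux_kahler_le v _ _).trans (Finset.sup_le fun i _ => ?_)
  induction i using Fin.addCases with
  | left i =>
    simp only [Fin.append_left]
    exact (Finset.le_sup (f := fun i => v (c i) * v (b i)) (Finset.mem_univ i)).trans hr.le
  | right i =>
    simp only [Fin.append_right]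
    exact (Finset.le_sup (f := fun i => v (c' i) * v (b' i)) (Finset.mem_univ i)).trans hr'.le

theorem aux_kahler_sum (v : B → ℝ≥0) {ι : Type*} (s : Finset ι) (f : ι → Ω[B⁄A]) (t : ℝ≥0)
    (h : ∀ i ∈ s, kahlerSeminorm A B v (f i) ≤ t) :
    kahlerSeminorm A B v (∑ i ∈ s, f i) ≤ t := by
  classical
  induction s using Finset.induction_on with
  | empty => simp [aux_kahler_zero]
  | insert a s ha ih =>
    rw [Finset.sum_insert ha]
    refine (aux_kahler_add v _ _).trans (max_le (h _ (by simp)) (ih fun i hi => h _ (by simp [hi])))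

end

theorem aux_tensor_le {A M N : Type*} [CommRing A] [AddCommGroup M] [Module A M]
    [AddCommGroup N] [Module A N] (vM : M → ℝ≥0) (vN : N → ℝ≥0) {n : ℕ} (m : Fin n → M)
    (w : Fin n → N) : tensorSeminorm A M N vM vN (∑ i, m i ⊗ₜ[A] w i) ≤
      Finset.univ.sup fun i => vM (m i) * vN (w i) :=
  csInf_le (OrderBot.bddBelow _) ⟨n, m, w, rfl, rfl⟩

theorem aux_tensor_rep {A M N : Type*} [CommRing A] [AddCommGroup M] [Module A M]
    [AddCommGroup N] [Module A N] (x : TensorProduct A M N) :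
    ∃ (n : ℕ) (m : Fin n → M) (w : Fin n → N), x = ∑ i, m i ⊗ₜ[A] w i := by
  induction x using TensorProduct.induction_on with
  | zero => exact ⟨0, fun _ => 0, fun _ => 0, by simp⟩
  | tmul a b => exact ⟨1, fun _ => a, fun _ => b, by simp⟩
  | add x y hx hy =>
    obtain ⟨n, c, b, rfl⟩ := hx
    obtain ⟨m, c', b', rfl⟩ := hy
    exact ⟨n + m, Fin.append c c', Fin.append b b', by simp [Fin.sum_univ_add]⟩

/-- Second fundamental sequence for seminormed rings: given non-expansive `A → B` and a
surjective non-expansive `φ : B → C` with kernel `J`, in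
`J/J² →(δ) Ω_{B/A} ⊗_B C →(g) Ω_{C/A} → 0` all maps are non-expansive (with `J` carrying the
restricted seminorm, `J/J²` the quotient seminorm, the middle term the tensor seminorm and
`Ω_{C/A}` the Kähler seminorm); and if `φ` is strictly admissible then `g` is strictly
admissible. -/
theorem second_fundamental_sequence_nonexpansive_strictly_admissible
    {A B C : Type*} [CommRing A] [CommRing B] [CommRing C]
    [Algebra A B] [Algebra A C] [Algebra B C] [IsScalarTower A B C]
    (vA : A → ℝ≥0) (vB : B → ℝ≥0) (vC : C → ℝ≥0)
    (hA : IsRingSeminorm vA) (hB : IsRingSeminorm vB) (hC : IsRingSeminorm vC)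
    (hAB : ∀ a : A, vB (algebraMap A B a) ≤ vA a)
    (hBC : ∀ b : B, vC (algebraMap B C b) ≤ vB b)
    (hsurj : Function.Surjective (algebraMap B C))
    (J : Ideal B) (hJ : J = RingHom.ker (algebraMap B C))
    (δ : J.Cotangent →+ TensorProduct B (Ω[B⁄A]) C)
    (hδ : ∀ x : J, δ (J.toCotangent x) = (KaehlerDifferential.D A B ↑x) ⊗ₜ[B] (1 : C))
    (g : TensorProduct B (Ω[B⁄A]) C →+ Ω[C⁄A])
    (hg : ∀ (b' b : B) (c : C),
      g ((b' • KaehlerDifferential.D A B b) ⊗ₜ[B] c)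
        = (c * algebraMap B C b') • KaehlerDifferential.D A C (algebraMap B C b)) :
    -- δ is non-expansive for the quotient seminorm on J/J² of the restricted seminorm on J
    (∀ y : J.Cotangent,
        tensorSeminorm B (Ω[B⁄A]) C (kahlerSeminorm A B vB) vC (δ y)
          ≤ quotientSeminorm (J.toCotangent) (fun x : J => vB ↑x) y) ∧
    -- g is non-expansive
    (∀ x, kahlerSeminorm A C vC (g x)
        ≤ tensorSeminorm B (Ω[B⁄A]) C (kahlerSeminorm A B vB) vC x) ∧
    -- if φ is strictly admissible, then g is strictly admissible
    ((∀ c : C, vC c = quotientSeminorm (algebraMap B C) vB c) →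
      ∀ y : Ω[C⁄A],
        quotientSeminorm g (tensorSeminorm B (Ω[B⁄A]) C (kahlerSeminorm A B vB) vC) y
          = kahlerSeminorm A C vC y) := by
  have hD : ∀ b : B, kahlerSeminorm A B vB (KaehlerDifferential.D A B b) ≤ vB b := fun b => by
    simpa [hB.2.1] using aux_kahler_smul_D_le (A := A) vB 1 b
  have hgexp : ∀ x, kahlerSeminorm A C vC (g x)
        ≤ tensorSeminorm B (Ω[B⁄A]) C (kahlerSeminorm A B vB) vC x := by
    intro x
    refine le_csInf ?_ ?_
    · obtain ⟨n, m, w, h⟩ := aux_tensor_rep x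
      exact ⟨_, n, m, w, h, rfl⟩
    rintro _ ⟨n, m, w, rfl, rfl⟩
    rw [map_sum]
    refine aux_kahler_sum _ _ _ _ fun i _ => ?_
    refine le_trans ?_
      (Finset.le_sup (f := fun i => kahlerSeminorm A B vB (m i) * vC (w i)) (Finset.mem_univ i))
    change _ ≤ kahlerSeminorm A B vB (m i) * vC (w i)
    rw [mul_comm]
    refine aux_le_mul_sInf (aux_kahler_nonempty vB (m i)) ?_
    rintro _ ⟨k, c, b, hm, rfl⟩
    rw [hm, TensorProduct.sum_tmul, map_sum]
    refine aux_kahler_sum _ _ _ _ fun j _ => ?_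
    rw [hg]
    refine (aux_kahler_smul_D_le vC _ _).trans ?_
    calc vC (w i * algebraMap B C (c j)) * vC (algebraMap B C (b j))
        ≤ (vC (w i) * vB (c j)) * vB (b j) := by
          refine mul_le_mul' ((hC.2.2 _ _).trans (mul_le_mul' le_rfl (hBC _))) (hBC _)
      _ = vC (w i) * (vB (c j) * vB (b j)) := mul_assoc _ _ _
      _ ≤ _ := mul_le_mul' le_rfl
        (Finset.le_sup (f := fun j => vB (c j) * vB (b j)) (Finset.mem_univ j))
  refine ⟨?_, hgexp, ?_⟩
  · intro y
    refine le_csInf ?_ ?_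
    · obtain ⟨x, hx⟩ := J.toCotangent_surjective y
      exact ⟨_, x, hx, rfl⟩
    rintro _ ⟨x, rfl, rfl⟩
    rw [hδ]
    have := aux_tensor_le (A := B) (kahlerSeminorm A B vB) vC (n := 1)
      (fun _ => KaehlerDifferential.D A B (x : B)) (fun _ => (1 : C))
    simp only [Finset.univ_unique, Finset.sum_singleton, Finset.sup_singleton, hC.2.1,
      mul_one] at this
    exact this.trans (hD _)
  · intro hadm y
    have key : ∀ t, kahlerSeminorm A C vC y < t → ∃ x, g x = y ∧
        tensorSeminorm B (Ω[B⁄A]) C (kahlerSeminorm A B vB) vC x ≤ t := by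
      intro t ht
      obtain ⟨_, ⟨n, c, b, hy, rfl⟩, hr⟩ := exists_lt_of_csInf_lt (aux_kahler_nonempty vC y) ht
      have hl : ∀ i, ∃ b' : B, algebraMap B C b' = b i ∧ vC (c i) * vB b' < t := by
        intro i
        have h1 : vC (c i) * vC (b i) < t := lt_of_le_of_lt
          (Finset.le_sup (f := fun i => vC (c i) * vC (b i)) (Finset.mem_univ i)) hr
        rw [hadm (b i)] at h1
        obtain ⟨b0, hb0⟩ := hsurj (b i)
        obtain ⟨_, ⟨b', hb', rfl⟩, h2⟩ := aux_exists_mul_lt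
          (S := { r | ∃ x : B, algebraMap B C x = b i ∧ r = vB x }) ⟨_, b0, hb0, rfl⟩ h1
        exact ⟨b', hb', h2⟩
      choose b' hb' hlt using hl
      refine ⟨∑ i, KaehlerDifferential.D A B (b' i) ⊗ₜ[B] c i, ?_, ?_⟩
      · rw [map_sum, hy]
        refine Finset.sum_congr rfl fun i _ => ?_
        have := hg 1 (b' i) (c i)
        rw [one_smul, map_one, mul_one, hb'] at this
        exact this
      · refine (aux_tensor_le _ _ _ _).trans (Finset.sup_le fun i _ => ?_)
        refine (mul_le_mul' (hD _) le_rfl).trans ?_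
        rw [mul_comm]
        exact (hlt i).le
    apply le_antisymm
    · refine le_of_forall_gt_imp_ge_of_dense fun t ht => ?_
      obtain ⟨x, hx, hxt⟩ := key t ht
      refine le_trans ?_ hxt
      exact csInf_le (OrderBot.bddBelow _) ⟨x, hx, rfl⟩
    · refine le_csInf ?_ ?_
      · obtain ⟨x, hx, -⟩ := key (kahlerSeminorm A C vC y + 1) (by simp)
        exact ⟨_, x, hx, rfl⟩
      rintro _ ⟨x, rfl, rfl⟩
      exact hgexp x
end

section
/- Let L/K be an extension of real-valued fields such that K is dense in L. Then the module of Kähler differentials Ω_{L°/K°} and the first homology H₁(𝕃_{L°/K°}) of the cotangent complex of L° over K° (equivalently, H¹ of the naive cotangent complex) are L-vector spaces; that is, for each of these two L°-modules, multiplication by every nonzero element of L° is bijective (equivalently, the module is divisible and torsion-free over L°). -/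
open scoped NNReal

set_option synthInstance.maxHeartbeats 400000
set_option maxHeartbeats 1000000

namespace DenseExt

open MvPolynomial

theorem span_fun {P ι : Type*} [CommRing P] (y : ι → P) (S : Finset ι) (v : P)
    (hv : v ∈ Ideal.span (y '' S)) : ∃ c : ι → P, ∑ j ∈ S, c j * y j = v := by
  classical
  obtain ⟨c, hc⟩ := (Submodule.mem_span_image_finset_iff_exists_fun P).1 hv
  refine ⟨fun i => if h : i ∈ S then c ⟨i, h⟩ else 0, ?_⟩
  rw [← hc, ← Finset.sum_coe_sort S]
  exact Finset.sum_congr rfl fun i _ => by simp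

theorem reg_aux {P ι : Type*} [CommRing P] (I : Ideal P) (x : P) (y : ι → P)
    (hy : ∀ j, y j ∈ I) (hI : ∀ e, x * e ∈ I → e ∈ I)
    (hreg : ∀ (S : Finset ι) (j : ι) (k : P), j ∉ S →
      y j * k ∈ Ideal.span {x} ⊔ Ideal.span (y '' S) →
      k ∈ Ideal.span {x} ⊔ Ideal.span (y '' S)) :
    ∀ (S : Finset ι) (k : ι → P), (∀ j, k j ∈ I) → x ∣ ∑ j ∈ S, k j * y j →
      ∃ s ∈ I ^ 2, ∑ j ∈ S, k j * y j = x * s := by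
  classical
  intro S
  induction S using Finset.induction_on with
  | empty => intro k _ _; exact ⟨0, zero_mem _, by simp⟩
  | insert j S hj ih =>
    intro k hk hdvd
    rw [Finset.sum_insert hj] at hdvd
    have h1 : k j ∈ Ideal.span {x} ⊔ Ideal.span (y '' S) := by
      apply hreg S j _ hj
      obtain ⟨t, ht⟩ := hdvd
      have : y j * k j = x * t - ∑ i ∈ S, k i * y i := by rw [← ht]; ring
      rw [this]
      apply sub_mem
      · exact Ideal.mem_sup_left (Ideal.mul_mem_right _ _ (Ideal.mem_span_singleton_self x))
      · apply Ideal.mem_sup_right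
        exact sum_mem fun i hi => Ideal.mul_mem_left _ _ (Ideal.subset_span ⟨i, hi, rfl⟩)
    obtain ⟨u, hu, v, hv, huv⟩ := Submodule.mem_sup.1 h1
    obtain ⟨e, rfl⟩ := Ideal.mem_span_singleton.1 hu
    obtain ⟨c, hc⟩ := span_fun y S v hv
    have hvI : v ∈ I := by
      rw [← hc]; exact sum_mem fun i _ => Ideal.mul_mem_left _ _ (hy i)
    have heI : e ∈ I := by
      apply hI
      have : x * e = k j - v := by rw [← huv]; ring
      rw [this]; exact sub_mem (hk j) hvI
    have key : k j * y j + ∑ i ∈ S, k i * y i =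
        x * (e * y j) + ∑ i ∈ S, (k i + c i * y j) * y i := by
      rw [← huv, ← hc]
      simp only [add_mul, Finset.sum_add_distrib, Finset.sum_mul, smul_eq_mul]
      have : ∑ i ∈ S, c i * y i * y j = ∑ i ∈ S, c i * y j * y i :=
        Finset.sum_congr rfl fun i _ => by ring
      rw [this]; ring
    obtain ⟨s, hs, hs'⟩ := ih (fun i => k i + c i * y j)
      (fun i => add_mem (hk i) (Ideal.mul_mem_left _ _ (hy j))) (by
        rw [key] at hdvd
        exact (dvd_add_right (dvd_mul_right x _)).1 hdvd)
    refine ⟨e * y j + s, add_mem ?_ hs, ?_⟩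
    · rw [pow_two]; exact Ideal.mul_mem_mul heI (hy j)
    · rw [Finset.sum_insert hj, key, hs']; ring

theorem mem_J_iff {ι A : Type*} [CommRing A] (x : A) (S : Finset ι) (p : MvPolynomial ι A) :
    p ∈ Ideal.span {C x} ⊔ Ideal.span ((X : ι → MvPolynomial ι A) '' S) ↔
      ∀ m : ι →₀ ℕ, (∀ j ∈ S, m j = 0) → x ∣ coeff m p := by
  classical
  constructor
  · intro h m hm
    obtain ⟨u, hu, v, hv, rfl⟩ := Submodule.mem_sup.1 h
    obtain ⟨e, rfl⟩ := Ideal.mem_span_singleton.1 hu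
    rw [coeff_add, coeff_C_mul]
    have : coeff m v = 0 := by
      by_contra hne
      obtain ⟨i, hi, hi'⟩ := mem_ideal_span_X_image.1 hv m (mem_support_iff.2 hne)
      exact hi' (hm i hi)
    rw [this, add_zero]; exact dvd_mul_right _ _
  · intro h
    rw [p.as_sum]
    refine sum_mem fun m _ => ?_
    by_cases hm : ∀ j ∈ S, m j = 0
    · obtain ⟨t, ht⟩ := h m hm
      rw [ht, ← C_mul_monomial]
      exact Ideal.mem_sup_left (Ideal.mul_mem_right _ _ (Ideal.mem_span_singleton_self _))
    · push Not at hm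
      obtain ⟨j, hj, hj'⟩ := hm
      apply Ideal.mem_sup_right
      rw [mem_ideal_span_X_image]
      intro m' hm'
      have := support_monomial_subset hm'
      rw [Finset.mem_singleton] at this
      subst this
      exact ⟨j, hj, hj'⟩

theorem sup_span_eq {P ι : Type*} [CommRing P] (x : P) (y z : ι → P) (S : Set ι)
    (h : ∀ j, x ∣ y j - z j) :
    Ideal.span {x} ⊔ Ideal.span (y '' S) ≤ Ideal.span {x} ⊔ Ideal.span (z '' S) := by
  refine sup_le le_sup_left (Ideal.span_le.2 ?_)
  rintro _ ⟨j, hj, rfl⟩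
  obtain ⟨t, ht⟩ := h j
  have : y j = x * t + z j := by rw [← ht]; ring
  rw [this]
  exact add_mem (Ideal.mem_sup_left (Ideal.mul_mem_right _ _ (Ideal.mem_span_singleton_self _)))
    (Ideal.mem_sup_right (Ideal.subset_span ⟨j, hj, rfl⟩))

section
variable {A B : Type*} [CommRing A] [CommRing B] [Algebra A B] (x : A)

/-- generators `x * b`. -/
noncomputable abbrev ev : MvPolynomial B A →ₐ[A] B := aeval (fun b : B => algebraMap A B x * b)

variable (α : B → A) (γ : B → B)

/-- elements of the kernel -/
noncomputable def yy (b : B) : MvPolynomial B A := X b - C x * (C (α b) + X (γ b))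

theorem yy_sub (b : B) : C x ∣ yy x α γ b - X b := ⟨-(C (α b) + X (γ b)), by unfold yy; ring⟩

variable (hαγ : ∀ b, b = algebraMap A B (α b) + algebraMap A B x * γ b)
include hαγ

theorem yy_mem (b : B) : yy x α γ b ∈ RingHom.ker (ev (B := B) x) := by
  rw [RingHom.mem_ker]
  simp only [yy, map_sub, map_mul, map_add, aeval_X, aeval_C]
  conv_lhs => enter [1, 2]; rw [hαγ b]
  ring

theorem ev_surj : Function.Surjective (ev (A := A) (B := B) x) := fun b =>
  ⟨C (α b) + X (γ b), by simp [aeval_X, aeval_C, ← hαγ b]⟩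

omit hαγ in
theorem mem_of_mul [IsDomain B] (hx : algebraMap A B x ≠ 0) (e : MvPolynomial B A)
    (h : C x * e ∈ RingHom.ker (ev (B := B) x)) : e ∈ RingHom.ker (ev (B := B) x) := by
  rw [RingHom.mem_ker] at *
  rw [map_mul, aeval_C] at h
  exact (mul_eq_zero.1 h).resolve_left hx

omit hαγ in
theorem mem_J_of_ker (h2 : ∀ a : A, algebraMap A B x ∣ algebraMap A B a → x ∣ a)
    (g : MvPolynomial B A) (hg : g ∈ RingHom.ker (ev (B := B) x)) :
    g ∈ Ideal.span {C x} ⊔ Ideal.span (yy x α γ '' g.vars) := by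
  classical
  refine sup_span_eq (C x) X _ _ (fun j => by
    rw [← dvd_neg, neg_sub]; exact yy_sub x α γ j) ?_
  rw [mem_J_iff]
  intro m hm
  by_cases hc : coeff m g = 0
  · rw [hc]; exact dvd_zero _
  have hm0 : m = 0 := by
    ext j
    by_contra hj
    exact hj (hm j ((mem_vars_iff_mem_support j).2 ⟨m, mem_support_iff.2 hc, Finsupp.mem_support_iff.2 hj⟩))
  subst hm0
  apply h2
  rw [← Ideal.mem_span_singleton, ← Ideal.Quotient.eq_zero_iff_mem]
  rw [RingHom.mem_ker] at hg
  have := congrArg (Ideal.Quotient.mkₐ A (Ideal.span {algebraMap A B x})) hg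
  rw [map_zero, ← AlgHom.comp_apply, comp_aeval] at this
  have hz : (fun i : B => (Ideal.Quotient.mkₐ A (Ideal.span {algebraMap A B x}))
      (algebraMap A B x * i)) = 0 := by
    funext i
    rw [Ideal.Quotient.mkₐ_eq_mk, Pi.zero_apply, Ideal.Quotient.eq_zero_iff_mem]
    exact Ideal.mul_mem_right _ _ (Ideal.mem_span_singleton_self _)
  rw [hz, aeval_zero] at this
  exact this

omit hαγ in
theorem exists_repr [IsDomain B] (hx : algebraMap A B x ≠ 0)
    (hy : ∀ b, yy x α γ b ∈ RingHom.ker (ev (B := B) x))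
    (h2 : ∀ a : A, algebraMap A B x ∣ algebraMap A B a → x ∣ a)
    (g : MvPolynomial B A) (hg : g ∈ RingHom.ker (ev (B := B) x)) :
    ∃ (S : Finset B) (c : B → MvPolynomial B A) (r : MvPolynomial B A),
      r ∈ RingHom.ker (ev (B := B) x) ∧ g = C x * r + ∑ j ∈ S, c j * yy x α γ j := by
  classical
  obtain ⟨u, hu, v, hv, huv⟩ := Submodule.mem_sup.1 (mem_J_of_ker x α γ h2 g hg)
  obtain ⟨r, rfl⟩ := Ideal.mem_span_singleton.1 hu
  obtain ⟨c, hc⟩ := span_fun _ _ v hv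
  refine ⟨g.vars, c, r, mem_of_mul x hx _ ?_, by rw [hc, huv]⟩
  have : C x * r = g - v := by rw [← huv]; ring
  rw [this]
  refine sub_mem hg ?_
  rw [← hc]
  exact sum_mem fun i _ => Ideal.mul_mem_left _ _ (hy i)

theorem sq_of_mul [IsDomain A] [IsDomain B] (hx0 : x ≠ 0) (hx : algebraMap A B x ≠ 0)
    (h2 : ∀ a : A, algebraMap A B x ∣ algebraMap A B a → x ∣ a)
    (f : MvPolynomial B A) (hf : C x * f ∈ RingHom.ker (ev (B := B) x) ^ 2) :
    f ∈ RingHom.ker (ev (B := B) x) ^ 2 := by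
  classical
  set I := RingHom.ker (ev (B := B) x) with hIdef
  have hy : ∀ b, yy x α γ b ∈ I := yy_mem x α γ hαγ
  have hle : I ≤ Ideal.span {C x} * I ⊔ Ideal.span (Set.range (yy x α γ)) := by
    intro g hg
    obtain ⟨S, c, r, hr, rfl⟩ := exists_repr x α γ hx hy h2 g hg
    refine add_mem (Ideal.mem_sup_left (Ideal.mul_mem_mul (Ideal.mem_span_singleton_self _) hr))
      (Ideal.mem_sup_right (sum_mem fun i _ => Ideal.mul_mem_left _ _
        (Ideal.subset_span ⟨i, rfl⟩)))
  have hle2 : I ^ 2 ≤ Ideal.span {C x} * I ^ 2 ⊔ I • Ideal.span (Set.range (yy x α γ)) := by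
    calc I ^ 2 = I * I := pow_two I
      _ ≤ I * (Ideal.span {C x} * I ⊔ Ideal.span (Set.range (yy x α γ))) :=
        Ideal.mul_mono_right hle
      _ = _ := by rw [Ideal.mul_sup, smul_eq_mul]; congr 1; ring
  obtain ⟨u, hu, v, hv, huv⟩ := Submodule.mem_sup.1 (hle2 hf)
  obtain ⟨s, hs, rfl⟩ := Ideal.mem_span_singleton_mul.1 hu
  obtain ⟨k, hk, rfl⟩ := (Submodule.mem_ideal_smul_span_iff_exists_sum _ _ _).1 hv
  have hreg : ∀ (S : Finset B) (j : B) (k : MvPolynomial B A), j ∉ S →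
      yy x α γ j * k ∈ Ideal.span {C x} ⊔ Ideal.span (yy x α γ '' S) →
      k ∈ Ideal.span {C x} ⊔ Ideal.span (yy x α γ '' S) := by
    intro S j k hj h
    have h' := sup_span_eq (C x) (yy x α γ) X S (yy_sub x α γ) h
    refine sup_span_eq (C x) X _ _ (fun j => by
      rw [← dvd_neg, neg_sub]; exact yy_sub x α γ j) ?_
    rw [mem_J_iff] at h' ⊢
    intro m hm
    have h3 := h' (m + Finsupp.single j 1) (fun i hi => by
      have : j ≠ i := fun h => hj (h ▸ hi)
      simp [hm i hi, Finsupp.single_eq_of_ne, this, Ne.symm this])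
    obtain ⟨t, ht⟩ := yy_sub x α γ j
    have h4 : yy x α γ j * k = C x * (t * k) + k * X j := by
      rw [show yy x α γ j = C x * t + X j by rw [← ht]; ring]; ring
    rw [h4, coeff_add, coeff_C_mul, coeff_mul_X] at h3
    exact (dvd_add_right (dvd_mul_right x _)).1 h3
  have hsum : (k.sum fun i c => c • yy x α γ i) = ∑ j ∈ k.support, k j * yy x α γ j := rfl
  rw [hsum] at huv
  obtain ⟨s', hs', hs''⟩ := reg_aux I (C x) (yy x α γ) hy (mem_of_mul x hx) hreg k.support k hk
    ⟨f - s, by rw [mul_sub, ← huv]; ring⟩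
  have : f = s + s' := by
    have hc : (C x : MvPolynomial B A) ≠ 0 := by simpa using hx0
    apply mul_left_cancel₀ hc
    rw [← huv, hs'']; ring
  rw [this]
  exact add_mem hs hs'

theorem exists_div [IsDomain B] (hx : algebraMap A B x ≠ 0)
    (h2 : ∀ a : A, algebraMap A B x ∣ algebraMap A B a → x ∣ a)
    (f : MvPolynomial B A) (hf : f ∈ RingHom.ker (ev (B := B) x))
    (hd : ∀ i, algebraMap A B x ∣ ev (B := B) x (pderiv i f)) :
    ∃ f' ∈ RingHom.ker (ev (B := B) x), f - C x * f' ∈ RingHom.ker (ev (B := B) x) ^ 2 := by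
  classical
  have hy := yy_mem x α γ hαγ
  obtain ⟨S, c, r, hr, rfl⟩ := exists_repr x α γ hx hy h2 f hf
  have hc : ∀ i ∈ S, algebraMap A B x ∣ ev (B := B) x (c i) := by
    intro i hi
    have h := hd i
    rw [← Ideal.mem_span_singleton, ← Ideal.Quotient.eq_zero_iff_mem] at h ⊢
    have hq : (Ideal.Quotient.mk (Ideal.span {algebraMap A B x})) (algebraMap A B x) = 0 :=
      Ideal.Quotient.eq_zero_iff_mem.2 (Ideal.mem_span_singleton_self _)
    have hyj : ∀ j, ev (B := B) x (yy x α γ j) = 0 := hy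
    have hpd : ∀ j, (Ideal.Quotient.mk (Ideal.span {algebraMap A B x}))
        (ev (B := B) x (pderiv i (yy x α γ j))) = if j = i then 1 else 0 := by
      intro j
      simp only [yy, map_sub, pderiv_C_mul, map_add, map_mul, aeval_C, hq, zero_mul, sub_zero]
      rw [pderiv_X, Pi.single_apply]
      by_cases hji : j = i
      · simp [hji]
      · simp [hji]
    rw [map_add, pderiv_C_mul, map_add, map_add, map_mul, aeval_C, map_mul, hq,
      zero_mul, zero_add, map_sum, map_sum, map_sum] at h
    simp only [Derivation.leibniz, smul_eq_mul, map_add, map_mul, hyj, hpd, map_zero,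
      zero_mul, add_zero] at h
    simpa [hi] using h
  choose! q hq using hc
  have hsj := ev_surj x α γ hαγ
  choose s hs using hsj
  refine ⟨r + ∑ j ∈ S, s (q j) * yy x α γ j, add_mem hr (sum_mem fun i _ =>
    Ideal.mul_mem_left _ _ (hy i)), ?_⟩
  have : C x * r + ∑ j ∈ S, c j * yy x α γ j - C x * (r + ∑ j ∈ S, s (q j) * yy x α γ j) =
      ∑ j ∈ S, (c j - C x * s (q j)) * yy x α γ j := by
    simp only [sub_mul, Finset.sum_sub_distrib, mul_add, Finset.mul_sum, mul_assoc]
    ring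
  rw [this, pow_two]
  refine sum_mem fun j hj => Ideal.mul_mem_mul ?_ (hy j)
  rw [RingHom.mem_ker, map_sub, map_mul, hs, aeval_C, hq j hj, sub_self]

open Algebra in
theorem bij [IsDomain A] [IsDomain B] (hx0 : x ≠ 0) (hx : algebraMap A B x ≠ 0)
    (h2 : ∀ a : A, algebraMap A B x ∣ algebraMap A B a → x ∣ a) :
    Function.Bijective (fun w : Ω[B⁄A] => algebraMap A B x • w) ∧
    Function.Bijective (fun w : Algebra.H1Cotangent A B => algebraMap A B x • w) := by
  classical
  let G : Generators A B B := Generators.ofSurjective _ (ev_surj x α γ hαγ)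
  let E := G.toExtension
  have hker : E.ker = RingHom.ker (ev (B := B) x) := rfl
  let cx : E.Ring := (C x : MvPolynomial B A)
  have hsm : ∀ (f : E.ker), algebraMap A B x • Extension.Cotangent.mk f =
      Extension.Cotangent.mk (P := E) (cx • f) := by
    intro f
    rw [map_smul]
    rw [← algebraMap_smul B cx]
    congr 1
    exact (aeval_C _ x).symm
  -- torsion free
  have tf1 : ∀ c : E.Cotangent, algebraMap A B x • c = 0 → c = 0 := by
    intro c hc
    obtain ⟨f, rfl⟩ := Extension.Cotangent.mk_surjective c
    rw [hsm, Extension.Cotangent.mk_eq_zero_iff] at hc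
    rw [Extension.Cotangent.mk_eq_zero_iff]
    exact sq_of_mul x α γ hαγ hx0 hx h2 f.1 hc
  have tf0 : ∀ c : E.CotangentSpace, algebraMap A B x • c = 0 → c = 0 := by
    intro c hc
    apply G.cotangentSpaceBasis.repr.injective
    ext i
    have := congrArg (fun z => G.cotangentSpaceBasis.repr z i) hc
    simp only [map_smul, Finsupp.smul_apply, map_zero, Finsupp.zero_apply, smul_eq_mul] at this
    simpa using (mul_eq_zero.1 this).resolve_left hx
  have dv : ∀ (c : E.Cotangent) (w : E.CotangentSpace),
      E.cotangentComplex c = algebraMap A B x • w → ∃ c', c = algebraMap A B x • c' := by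
    intro c w h
    obtain ⟨f, rfl⟩ := Extension.Cotangent.mk_surjective c
    obtain ⟨f', hf', hff⟩ := exists_div x α γ hαγ hx h2 f.1 f.2 (by
      intro i
      have := congrArg (fun z => G.cotangentSpaceBasis.repr z i) h
      simp only [map_smul, Finsupp.smul_apply, smul_eq_mul] at this
      refine ⟨_, Eq.trans ?_ this⟩
      rw [Extension.cotangentComplex_mk]
      exact (G.cotangentSpaceBasis_repr_one_tmul f.1 i).symm)
    refine ⟨Extension.Cotangent.mk ⟨f', hf'⟩, ?_⟩
    rw [hsm, Extension.Cotangent.mk_eq_mk_iff_sub_mem]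
    exact hff
  refine ⟨⟨?_, ?_⟩, ?_⟩
  · change Function.Injective (DistribSMul.toAddMonoidHom (Ω[B⁄A]) (algebraMap A B x))
    rw [injective_iff_map_eq_zero]
    intro w hw
    change algebraMap A B x • w = 0 at hw
    obtain ⟨c, rfl⟩ := E.toKaehler_surjective w
    rw [← map_smul] at hw
    obtain ⟨i, hi⟩ := (E.exact_cotangentComplex_toKaehler _).1 hw
    obtain ⟨i', rfl⟩ := dv i c hi
    have : c = E.cotangentComplex i' := by
      rw [← sub_eq_zero]
      apply tf0
      rw [smul_sub, ← map_smul, hi, sub_self]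
    rw [this]
    exact (E.exact_cotangentComplex_toKaehler _).2 ⟨i', rfl⟩
  · intro w
    have hw : w ∈ Submodule.span B (Set.range (KaehlerDifferential.D A B)) := by
      rw [KaehlerDifferential.span_range_derivation]; trivial
    induction hw using Submodule.span_induction with
    | mem w h =>
      obtain ⟨b, rfl⟩ := h
      refine ⟨KaehlerDifferential.D A B (γ b), ?_⟩
      conv_rhs => rw [hαγ b]
      simp
    | zero => exact ⟨0, smul_zero _⟩
    | add a b _ _ ha hb =>
      obtain ⟨a, rfl⟩ := ha
      obtain ⟨b, rfl⟩ := hb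
      exact ⟨a + b, smul_add _ _ _⟩
    | smul r a _ ha =>
      obtain ⟨a, rfl⟩ := ha
      exact ⟨r • a, smul_comm _ _ _⟩
  · have hb : Function.Bijective (fun w : E.H1Cotangent => algebraMap A B x • w) := by
      constructor
      · change Function.Injective (DistribSMul.toAddMonoidHom E.H1Cotangent (algebraMap A B x))
        rw [injective_iff_map_eq_zero]
        intro w hw
        exact Extension.h1Cotangentι_ext _ _ (tf1 w.1 (congrArg Subtype.val hw))
      · intro w
        obtain ⟨c', hc'⟩ := dv w.1 0 (by rw [smul_zero]; exact w.2)
        refine ⟨⟨c', ?_⟩, Extension.h1Cotangentι_ext _ _ hc'.symm⟩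
        apply tf0
        rw [← map_smul, ← hc']
        exact w.2
    let e := G.equivH1Cotangent
    have : (fun w : Algebra.H1Cotangent A B => algebraMap A B x • w) =
        e ∘ (fun w : E.H1Cotangent => algebraMap A B x • w) ∘ e.symm := by
      funext w
      simp only [Function.comp_apply]
      rw [map_smul, e.apply_symm_apply]
    rw [this]
    exact e.bijective.comp (hb.comp e.symm.bijective)

end

theorem bij_unit_mul {B M : Type*} [CommRing B] [AddCommGroup M] [Module B M] (u : Bˣ) (x : B)
    (h : Function.Bijective (fun m : M => x • m)) :
    Function.Bijective (fun m : M => (↑u * x) • m) := by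
  have : (fun m : M => ((u : B) * x) • m) = (fun m => u • m) ∘ (fun m : M => x • m) := by
    funext m; simp [mul_smul, Units.smul_def]
  rw [this]
  exact (MulAction.bijective u).comp h

end DenseExt


/-- If `L/K` is an extension of real-valued fields with `K` dense in `L`, then the module of
Kähler differentials `Ω_{L°/K°}` and the first homology `H₁(𝕃_{L°/K°})` of the cotangent complex
(i.e. `H¹` of the naive cotangent complex) are `L`-vector spaces: multiplication by any nonzero
element of `L°` is bijective on each of them. -/
theorem omega_and_H1Cotangent_of_dense_extension_are_vector_spaces
    {K L : Type*} [Field K] [Field L] [Algebra K L]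
    (vK : Valuation K ℝ≥0) (vL : Valuation L ℝ≥0)
    (hext : ∀ x : K, vL (algebraMap K L x) = vK x)
    (hdense : ∀ (l : L) (ε : ℝ≥0), 0 < ε → ∃ x : K, vL (l - algebraMap K L x) < ε)
    [Algebra ↥vK.integer ↥vL.integer]
    (hcomp : ∀ x : vK.integer,
      ((algebraMap ↥vK.integer ↥vL.integer x : ↥vL.integer) : L) = algebraMap K L ↑x) :
    (∀ a : ↥vL.integer, a ≠ 0 →
      Function.Bijective (fun x : Ω[↥vL.integer⁄↥vK.integer] => a • x)) ∧
    (∀ a : ↥vL.integer, a ≠ 0 →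
      Function.Bijective
        (fun x : Algebra.H1Cotangent ↥vK.integer ↥vL.integer => a • x)) := by
  classical
  have dvd_of_le : ∀ a b : vL.integer, vL (b : L) ≤ vL (a : L) → a ∣ b := by
    intro a b h
    exact (Valuation.integer.integers vL).dvd_of_le h
  have approx : ∀ (b a : vL.integer), a ≠ 0 → ∃ y : vK.integer,
      vL ((b : L) - algebraMap K L y) < vL (a : L) := by
    intro b a ha
    have ha' : 0 < vL (a : L) := by
      rw [pos_iff_ne_zero, Valuation.ne_zero_iff]
      exact fun h => ha (Subtype.ext h)
    obtain ⟨y, hy⟩ := hdense b (vL (a : L)) ha'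
    refine ⟨⟨y, ?_⟩, hy⟩
    change vK y ≤ 1
    rw [← hext]
    have : algebraMap K L y = b - (b - algebraMap K L y) := by ring
    rw [this]
    exact (vL.map_sub _ _).trans (max_le b.2 (hy.le.trans a.2))
  have main : ∀ a : vL.integer, a ≠ 0 → ∃ (x : vK.integer) (u : (vL.integer)ˣ),
      a = u * algebraMap vK.integer vL.integer x := by
    intro a ha
    obtain ⟨y, hy⟩ := approx a a ha
    have hv : vL (algebraMap K L y) = vL (a : L) := by
      have := vL.map_sub_eq_of_lt_right hy
      rw [sub_sub_cancel_left, Valuation.map_neg] at this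
      exact this
    have h1 : algebraMap vK.integer vL.integer y ∣ a := dvd_of_le _ _ (by rw [hcomp, hv])
    have h2 : a ∣ algebraMap vK.integer vL.integer y := dvd_of_le _ _ (by rw [hcomp, hv])
    obtain ⟨u, hu⟩ := associated_of_dvd_dvd h1 h2
    exact ⟨y, u, by rw [← hu, mul_comm]⟩
  have key : ∀ a : vL.integer, a ≠ 0 →
      Function.Bijective (fun w : Ω[↥vL.integer⁄↥vK.integer] => a • w) ∧
      Function.Bijective (fun w : Algebra.H1Cotangent ↥vK.integer ↥vL.integer => a • w) := by
    intro a ha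
    obtain ⟨x, u, rfl⟩ := main a ha
    have hx : algebraMap vK.integer vL.integer x ≠ 0 := fun h => ha (by rw [h, mul_zero])
    have hx0 : x ≠ 0 := fun h => hx (by rw [h, map_zero])
    have hαγ : ∀ b : vL.integer, ∃ (y : vK.integer) (c : vL.integer),
        b = algebraMap _ _ y + algebraMap vK.integer vL.integer x * c := by
      intro b
      obtain ⟨y, hy⟩ := approx b _ hx
      obtain ⟨c, hc⟩ := dvd_of_le (algebraMap _ _ x) (b - algebraMap _ _ y) (by
        rw [AddSubgroupClass.coe_sub, hcomp y]; exact hy.le)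
      exact ⟨y, c, by rw [← hc]; ring⟩
    choose α γ h using hαγ
    have h2 : ∀ y : vK.integer, algebraMap vK.integer vL.integer x ∣
        algebraMap vK.integer vL.integer y → x ∣ y := by
      rintro y ⟨c, hc⟩
      apply (Valuation.integer.integers vK).dvd_of_le
      change vK (y : K) ≤ vK (x : K)
      rw [← hext, ← hext, ← hcomp, ← hcomp, hc, Subring.coe_mul, map_mul]
      exact mul_le_of_le_one_right' c.2
    obtain ⟨r1, r2⟩ := DenseExt.bij x α γ h hx0 hx h2
    exact ⟨DenseExt.bij_unit_mul u _ r1, DenseExt.bij_unit_mul u _ r2⟩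
  exact ⟨fun a ha => (key a ha).1, fun a ha => (key a ha).2⟩
end

section
/- Let L/K be a finite separable extension of real-valued fields. Then the different δ_{L/K} = cont((Ω_{L°/K°})_tor), the content of the torsion submodule of the K°-module (indeed L°-module) of Kähler differentials Ω_{L°/K°}, is strictly positive. -/
open scoped NNReal

set_option synthInstance.maxHeartbeats 400000
set_option maxHeartbeats 1000000

/-- The content of a module `M` over a ring `R` equipped with an absolute value `v`:
the infimum, over all finitely presented subquotients of `M` decomposed as
`⊕ᵢ R/πᵢR`, of `∏ᵢ v πᵢ`. -/
noncomputable def content (R : Type*) [CommRing R] (v : R → ℝ≥0)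
    (M : Type*) [AddCommGroup M] [Module R M] : ℝ≥0 :=
  sInf { r | ∃ (N₁ : Submodule R M) (N₂ : Submodule R ↥N₁) (n : ℕ) (π : Fin n → R),
    Nonempty ((↥N₁ ⧸ N₂) ≃ₗ[R] ((i : Fin n) → R ⧸ Ideal.span {π i})) ∧
    r = ∏ i, v (π i) }

open TensorProduct in
lemma annih_aux {O K S L : Type*} [CommRing O] [IsDomain O] [ValuationRing O]
    [Field K] [CommRing S] [Field L] [Algebra O K] [IsFractionRing O K] [Algebra K L]
    [Algebra O S] [Algebra S L] [Algebra O L] [IsScalarTower O K L] [IsScalarTower O S L]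
    [FiniteDimensional K L] [Algebra.IsSeparable K L]
    (hinj : Function.Injective (algebraMap S L))
    (hint : ∀ x : L, IsIntegral O x → ∃ s : S, algebraMap S L s = x) :
    ∃ c : O, c ≠ 0 ∧ ∀ w : Ω[S⁄O], algebraMap O S c • w = 0 := by
  have hOK : Function.Injective (algebraMap O K) := IsFractionRing.injective O K
  have hOL : Function.Injective (algebraMap O L) := by
    rw [IsScalarTower.algebraMap_eq O K L]
    exact (algebraMap K L).injective.comp hOK
  have hOS : Function.Injective (algebraMap O S) := by
    have := hOL
    rw [IsScalarTower.algebraMap_eq O S L, RingHom.coe_comp] at this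
    exact this.of_comp
  have : IsDomain S := hinj.isDomain (algebraMap S L)
  have tfL : Module.Flat O L := by
    rw [Module.Flat.flat_iff_torsion_eq_bot_of_isBezout, ← Submodule.isTorsionFree_iff_torsion_eq_bot]
    have : FaithfulSMul O L := (faithfulSMul_iff_algebraMap_injective O L).2 hOL
    infer_instance
  have tfS : Module.Flat O S := by
    rw [Module.Flat.flat_iff_torsion_eq_bot_of_isBezout, ← Submodule.isTorsionFree_iff_torsion_eq_bot]
    have : FaithfulSMul O S := (faithfulSMul_iff_algebraMap_injective O S).2 hOS
    infer_instance
  have : Algebra.FormallyUnramified K L := .of_isSeparable K L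
  have : Algebra.FormallyUnramified O K := .of_isLocalization (nonZeroDivisors O)
  have : Algebra.FormallyUnramified O L := .comp O K L
  have : Algebra.EssFiniteType O K := .of_isLocalization _ (nonZeroDivisors O)
  have : Algebra.EssFiniteType O L := .comp O K L
  have : Algebra.IsAlgebraic O K := IsLocalization.isAlgebraic K (nonZeroDivisors O)
  have : Algebra.IsAlgebraic O L := Algebra.IsAlgebraic.trans O K L
  let i : S →ₐ[O] L := IsScalarTower.toAlgHom O S L
  let F : S ⊗[O] S →ₐ[O] L ⊗[O] L := Algebra.TensorProduct.map i i
  have hi : Function.Injective i.toLinearMap := hinj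
  have hF : Function.Injective F := by
    have := TensorProduct.map_injective_of_flat_flat i.toLinearMap i.toLinearMap hi hi
    exact this
  have key : ∀ e : L ⊗[O] L, ∃ c : O, c ≠ 0 ∧ ∃ e' : S ⊗[O] S, F e' = c • e := by
    intro e
    induction e using TensorProduct.induction_on with
    | zero => exact ⟨1, one_ne_zero, 0, by simp⟩
    | tmul x y =>
      obtain ⟨a, ha, hax⟩ := (Algebra.IsAlgebraic.isAlgebraic (R := O) x).exists_integral_multiple
      obtain ⟨b, hb, hby⟩ := (Algebra.IsAlgebraic.isAlgebraic (R := O) y).exists_integral_multiple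
      obtain ⟨s, hs⟩ := hint _ hax
      obtain ⟨t, ht⟩ := hint _ hby
      refine ⟨a * b, mul_ne_zero ha hb, s ⊗ₜ t, ?_⟩
      have : F (s ⊗ₜ t) = (algebraMap S L s) ⊗ₜ (algebraMap S L t) := rfl
      rw [this, hs, ht, TensorProduct.smul_tmul_smul]
    | add x y hx hy =>
      obtain ⟨a, ha, x', hx'⟩ := hx
      obtain ⟨b, hb, y', hy'⟩ := hy
      refine ⟨a * b, mul_ne_zero ha hb, b • x' + a • y', ?_⟩
      rw [map_add, map_smul, map_smul, hx', hy', smul_add, smul_smul, smul_smul, mul_comm b a]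
  obtain ⟨c, hc, e, he⟩ := key (Algebra.FormallyUnramified.elem O L)
  refine ⟨c, hc, ?_⟩
  have hmul : Algebra.TensorProduct.lmul' O e = algebraMap O S c := by
    apply hinj
    have h1 : ∀ e : S ⊗[O] S, algebraMap S L (Algebra.TensorProduct.lmul' O e) =
        Algebra.TensorProduct.lmul' O (F e) := by
      intro e
      induction e using TensorProduct.induction_on with
      | zero => simp
      | tmul x y => simp [F, i]
      | add x y hx hy => simp only [map_add, hx, hy]
    rw [h1, he, map_smul, Algebra.FormallyUnramified.lmul_elem, ← IsScalarTower.algebraMap_apply,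
      Algebra.algebraMap_eq_smul_one]
  have hcomm : ∀ y : S, ((1 : S) ⊗ₜ[O] y) * e = (y ⊗ₜ[O] (1 : S)) * e := by
    intro y
    apply hF
    have := Algebra.FormallyUnramified.one_tmul_mul_elem (R := O) (algebraMap S L y)
    have h1 : F (1 ⊗ₜ y) = 1 ⊗ₜ (algebraMap S L y) := by simp [F, i]
    have h2 : F (y ⊗ₜ 1) = (algebraMap S L y) ⊗ₜ 1 := by simp [F, i]
    rw [map_mul, map_mul, he, h1, h2, mul_smul_comm, mul_smul_comm, this]
  let ψ : S ⊗[O] S →ₗ[S] Ω[S⁄O] :=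
    TensorProduct.AlgebraTensorModule.lift
      ((LinearMap.lsmul S (S →ₗ[O] Ω[S⁄O])).flip (KaehlerDifferential.D O S).toLinearMap)
  have hψ : ∀ a b : S, ψ (a ⊗ₜ b) = a • KaehlerDifferential.D O S b := fun a b => rfl
  have hψ1 : ∀ (y : S) (e : S ⊗[O] S), ψ ((y ⊗ₜ[O] (1 : S)) * e) = y • ψ e := by
    intro y e
    induction e using TensorProduct.induction_on with
    | zero => simp
    | tmul a b => simp [hψ, mul_smul]
    | add a b ha hb => simp only [mul_add, map_add, smul_add, ha, hb]
  have hψ2 : ∀ (y : S) (e : S ⊗[O] S), ψ (((1 : S) ⊗ₜ[O] y) * e) =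
      Algebra.TensorProduct.lmul' O e • KaehlerDifferential.D O S y + y • ψ e := by
    intro y e
    induction e using TensorProduct.induction_on with
    | zero => simp
    | tmul a b =>
      simp only [Algebra.TensorProduct.tmul_mul_tmul, one_mul, hψ, Derivation.leibniz,
        Algebra.TensorProduct.lmul'_apply_tmul, smul_add, mul_smul]
      rw [smul_comm a y, add_comm]
    | add a b ha hb =>
      simp only [mul_add, map_add, smul_add, ha, hb, add_smul]
      abel
  have hD : ∀ y : S, algebraMap O S c • KaehlerDifferential.D O S y = 0 := by
    intro y
    have h := hψ2 y e
    rw [hcomm, hψ1, hmul] at h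
    simpa using h
  intro w
  have hw : w ∈ Submodule.span S (Set.range (KaehlerDifferential.D O S)) := by
    rw [KaehlerDifferential.span_range_derivation]; trivial
  induction hw using Submodule.span_induction with
  | mem x hx => obtain ⟨y, rfl⟩ := hx; exact hD y
  | zero => simp
  | add x y _ _ hx hy => rw [smul_add, hx, hy, add_zero]
  | smul a x _ hx => rw [smul_comm, hx, smul_zero]

open scoped NNReal in
lemma rel_aux {K E ι : Type*} [Field K] (v : Valuation K ℝ≥0) [AddCommGroup E] [Module K E]
    [FiniteDimensional K E] [Fintype ι] (f : ι → E) (h : Module.finrank K E < Fintype.card ι) :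
    ∃ r : ι → K, (∀ i, v (r i) ≤ 1) ∧ (∃ i, r i = 1) ∧ ∑ i, r i • f i = 0 := by
  have hd : ¬ LinearIndependent K f := fun hl => absurd hl.fintype_card_le_finrank (not_le.2 h)
  rw [Fintype.linearIndependent_iff] at hd
  push Not at hd
  obtain ⟨g, hg, j, hj⟩ := hd
  obtain ⟨k, -, hk⟩ := Finset.exists_max_image Finset.univ (fun i => v (g i)) ⟨j, Finset.mem_univ j⟩
  have hk0 : g k ≠ 0 := by
    intro h0
    have := hk j (Finset.mem_univ j)
    rw [h0, map_zero, nonpos_iff_eq_zero, map_eq_zero] at this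
    exact hj this
  refine ⟨fun i => (g k)⁻¹ * g i, ?_, ⟨k, inv_mul_cancel₀ hk0⟩, ?_⟩
  · intro i
    have hp : 0 < v (g k) := by rw [pos_iff_ne_zero]; simpa using hk0
    rw [map_mul, map_inv₀, inv_mul_le_iff₀ hp, mul_one]
    exact hk i (Finset.mem_univ i)
  · simp only [mul_smul, ← Finset.smul_sum, hg, smul_zero]

open scoped NNReal in
lemma span_aux {K E M : Type*} [Field K] (v : Valuation K ℝ≥0) [AddCommGroup E] [Module K E]
    [FiniteDimensional K E] [AddCommGroup M] [Module v.integer M] (i : M →+ E)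
    (hi : Function.Injective i) (his : ∀ (a : v.integer) (m : M), i (a • m) = (a : K) • i m)
    (s : Finset M) : ∃ t : Finset M, t.card ≤ Module.finrank K E ∧
      (s : Set M) ⊆ Submodule.span v.integer (t : Set M) := by
  classical
  let P : ℕ → Prop := fun n => ∃ t : Finset M, t.card = n ∧
      (s : Set M) ⊆ Submodule.span v.integer (t : Set M)
  have hP : ∃ n, P n := ⟨s.card, s, rfl, Submodule.subset_span⟩
  obtain ⟨t, ht, hst⟩ := Nat.find_spec hP
  refine ⟨t, ?_, hst⟩
  by_contra hlt
  push Not at hlt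
  obtain ⟨r, hr, ⟨k, hk⟩, hsum⟩ := rel_aux v (fun m : t => i m) (by simpa using hlt)
  let r' : t → v.integer := fun m => ⟨r m, hr m⟩
  have hrel : ∑ m : t, r' m • (m : M) = 0 := by
    apply hi
    rw [map_sum, map_zero, ← hsum]
    exact Finset.sum_congr rfl fun m _ => his _ _
  have hk' : r' k = 1 := Subtype.ext hk
  rw [Fintype.sum_eq_add_sum_compl k, hk', one_smul] at hrel
  have hkmem : (k : M) ∈ Submodule.span v.integer ((t.erase k : Finset M) : Set M) := by
    have hneg := eq_neg_of_add_eq_zero_left hrel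
    refine (congrArg (· ∈ Submodule.span v.integer ((t.erase k : Finset M) : Set M)) hneg).mpr ?_
    refine neg_mem (sum_mem fun m hm => Submodule.smul_mem _ _ (Submodule.subset_span ?_))
    simp only [Finset.mem_compl, Finset.mem_singleton] at hm
    exact Finset.mem_coe.2 (Finset.mem_erase.2 ⟨Subtype.coe_ne_coe.2 hm, m.2⟩)
  refine Nat.find_min hP (m := (t.erase k).card) ?_ ⟨t.erase k, rfl, hst.trans ?_⟩
  · rw [← ht]; exact Finset.card_erase_lt_of_mem k.2
  · refine Submodule.span_le.2 fun m hm => ?_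
    by_cases hmk : m = k
    · rw [hmk]; exact hkmem
    · exact Submodule.subset_span (by simpa [hmk] using hm)

lemma gens_aux {K L : Type*} [Field K] [Field L] [Algebra K L]
    [FiniteDimensional K L]
    (vK : Valuation K ℝ≥0) (vL : Valuation L ℝ≥0)
    [Algebra ↥vK.integer ↥vL.integer]
    (hcomp : ∀ x : vK.integer,
      ((algebraMap ↥vK.integer ↥vL.integer x : ↥vL.integer) : L) = algebraMap K L ↑x)
    {J : Type*} [Fintype J] (w : J → Ω[↥vL.integer⁄↥vK.integer])
    (hJ : Module.finrank K L < Fintype.card J) :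
    ∃ r : J → vL.integer, (∃ i, r i = 1) ∧ ∑ i, r i • w i = 0 := by
  classical
  let D := KaehlerDifferential.D vK.integer vL.integer
  have hex : ∀ i, ∃ s : Finset vL.integer,
      w i ∈ Submodule.span vL.integer (D '' (s : Set vL.integer)) := by
    intro i
    have hw : w i ∈ Submodule.span vL.integer (Set.range D) := by
      rw [KaehlerDifferential.span_range_derivation]; trivial
    rw [← Set.image_univ] at hw
    obtain ⟨T, hT, hT'⟩ := Submodule.mem_span_finite_of_mem_span hw
    obtain ⟨s, -, rfl⟩ := Finset.subset_set_image_iff.1 hT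
    exact ⟨s, by simpa using hT'⟩
  choose s hs using hex
  obtain ⟨t, htc, ht⟩ := span_aux (K := K) (E := L) vK (vL.integer.subtype : vL.integer →+ L)
    Subtype.val_injective (by
      intro a m
      rw [Algebra.smul_def, Algebra.smul_def]
      change ((algebraMap vK.integer vL.integer a * m : vL.integer) : L) = _
      rw [Subring.coe_mul, hcomp]
      rfl) (Finset.univ.biUnion s)
  have hspan : ∀ i, w i ∈ Submodule.span vL.integer (Set.range fun z : t => D z) := by
    intro i
    refine Submodule.span_le.2 ?_ (hs i)
    rintro _ ⟨y, hy, rfl⟩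
    have hy' := ht (show y ∈ _ from
      Finset.mem_coe.2 (Finset.mem_biUnion.2 ⟨i, Finset.mem_univ i, hy⟩))
    rw [SetLike.mem_coe] at hy' ⊢
    clear hy
    induction hy' using Submodule.span_induction with
    | mem x hx => exact Submodule.subset_span ⟨⟨x, hx⟩, rfl⟩
    | zero => rw [map_zero]; exact zero_mem _
    | add x y _ _ hx hy => rw [map_add]; exact add_mem hx hy
    | smul a x _ hx =>
      rw [Derivation.map_smul, ← algebraMap_smul vL.integer a]
      exact Submodule.smul_mem _ _ hx
  choose u hu using fun i => (Submodule.mem_span_range_iff_exists_fun _).1 (hspan i)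
  obtain ⟨r, hr, ⟨k, hk⟩, hsum⟩ := rel_aux vL (fun i => fun z : t => ((u i z : vL.integer) : L))
    (by simpa using htc.trans_lt hJ)
  refine ⟨fun i => ⟨r i, hr i⟩, ⟨k, Subtype.ext hk⟩, ?_⟩
  simp only [← hu, Finset.smul_sum, smul_smul]
  rw [Finset.sum_comm]
  refine Finset.sum_eq_zero fun z _ => ?_
  rw [← Finset.sum_smul]
  have : ∑ i, (⟨r i, hr i⟩ : vL.integer) * u i z = 0 := by
    apply Subtype.val_injective
    have := congrFun hsum z
    simpa using this
  rw [this, zero_smul]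

lemma quot_aux {R M : Type*} [CommRing R] [AddCommGroup M] [Module R M] (n : ℕ) (c : R)
    (hc : ∀ m : M, c • m = 0)
    (hM : ∀ (J : Type) [Fintype J] (w : J → M), n < Fintype.card J →
      ∃ r : J → R, (∃ i, r i = 1) ∧ ∑ i, r i • w i = 0)
    (N₁ : Submodule R M) (N₂ : Submodule R ↥N₁) (m : ℕ) (π : Fin m → R)
    (e : (↥N₁ ⧸ N₂) ≃ₗ[R] ((i : Fin m) → R ⧸ Ideal.span {π i})) :
    (∀ i, π i ∣ c) ∧ Nat.card {i // ¬ IsUnit (π i)} ≤ n := by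
  classical
  have hlift : ∀ x : ((i : Fin m) → R ⧸ Ideal.span {π i}), ∃ y : N₁, e (N₂.mkQ y) = x := by
    intro x
    obtain ⟨y, hy⟩ := N₂.mkQ_surjective (e.symm x)
    exact ⟨y, by rw [hy]; simp⟩
  choose g hg using hlift
  constructor
  · intro i
    have h1 : c • g (Pi.single i 1) = 0 := Subtype.ext (by simpa using hc _)
    have h2 : c • (Pi.single i 1 : (i : Fin m) → R ⧸ Ideal.span {π i}) = 0 := by
      rw [← hg (Pi.single i 1), ← map_smul, ← map_smul, h1, map_zero, map_zero]
    have h3 := congrFun h2 i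
    rw [Pi.smul_apply, Pi.single_eq_same, Pi.zero_apply, Algebra.smul_def, mul_one] at h3
    exact Ideal.mem_span_singleton.1 (Ideal.Quotient.eq_zero_iff_mem.1 h3)
  · by_contra hlt
    push Not at hlt
    rw [Nat.card_eq_fintype_card] at hlt
    obtain ⟨r, ⟨k, hk⟩, hr⟩ := hM _
      (fun i : {i // ¬ IsUnit (π i)} => ((g (Pi.single i.1 1) : N₁) : M)) hlt
    have h1 : ∑ i : {i // ¬ IsUnit (π i)}, r i • g (Pi.single i.1 1) = 0 :=
      Subtype.ext (by simpa using hr)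
    have h2 : ∑ i : {i // ¬ IsUnit (π i)},
        r i • (Pi.single i.1 1 : (i : Fin m) → R ⧸ Ideal.span {π i}) = 0 := by
      have := congrArg (fun y => e (N₂.mkQ y)) h1
      simpa only [map_sum, map_smul, hg, map_zero] using this
    have h3 := congrFun h2 k.1
    rw [Finset.sum_apply, Finset.sum_eq_single k, hk, one_smul, Pi.single_eq_same,
      Pi.zero_apply] at h3
    · have h4 : (1 : R) ∈ Ideal.span {π k.1} := by
        rw [← Ideal.Quotient.eq_zero_iff_mem]; simpa using h3
      exact k.2 (isUnit_of_dvd_one (Ideal.mem_span_singleton.1 h4))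
    · intro b _ hb
      rw [Pi.smul_apply, Pi.single_eq_of_ne (fun h => hb (Subtype.ext h.symm)), smul_zero]
    · intro h; exact absurd (Finset.mem_univ _) h

/-- For a finite separable extension `L/K` of real-valued fields, the different
`δ_{L/K} = cont((Ω_{L°/K°})_tor)` — the content of the torsion submodule of the module of Kähler
differentials `Ω_{L°/K°}` — is strictly positive. -/
theorem different_pos_of_finite_separable
    {K L : Type*} [Field K] [Field L] [Algebra K L]
    [FiniteDimensional K L] [Algebra.IsSeparable K L]
    (vK : Valuation K ℝ≥0) (vL : Valuation L ℝ≥0)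
    (hext : ∀ x : K, vL (algebraMap K L x) = vK x)
    [Algebra ↥vK.integer ↥vL.integer]
    (hcomp : ∀ x : vK.integer,
      ((algebraMap ↥vK.integer ↥vL.integer x : ↥vL.integer) : L) = algebraMap K L ↑x) :
    0 < content ↥vL.integer (fun a => vL ↑a)
        ↥(Submodule.torsion ↥vL.integer (Ω[↥vL.integer⁄↥vK.integer])) := by
  classical
  have hintK : ∀ x : vK.integer, vK x ≤ 1 := fun x => x.2
  have tower : IsScalarTower vK.integer vL.integer L := by
    refine IsScalarTower.of_algebraMap_eq fun x => ?_
    exact (hcomp x).symm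
  obtain ⟨c₀, hc₀, hann⟩ := annih_aux (O := vK.integer) (K := K) (S := vL.integer) (L := L)
    Subtype.val_injective (by
      intro x hx
      have hx' : IsIntegral vL.integer x := hx.tower_top
      exact ⟨⟨x, (Valuation.integer.integers vL).mem_of_integral hx'⟩, rfl⟩)
  set c : vL.integer := algebraMap vK.integer vL.integer c₀ with hcdef
  have hcL : (c : L) ≠ 0 := by
    rw [hcdef, hcomp, Ne, map_eq_zero]
    exact fun h => hc₀ (Subtype.ext h)
  have hcpos : 0 < vL (c : L) := by rw [pos_iff_ne_zero]; simpa using hcL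
  set n := Module.finrank K L
  refine lt_of_lt_of_le (pow_pos hcpos n) (le_csInf ?_ ?_)
  · exact ⟨_, ⊥, ⊤, 0, Fin.elim0, ⟨
      { toFun := fun _ => 0
        invFun := fun _ => 0
        left_inv := fun _ => Subsingleton.elim _ _
        right_inv := fun _ => Subsingleton.elim _ _
        map_add' := fun _ _ => by simp
        map_smul' := fun _ _ => by simp }⟩, rfl⟩
  · rintro _ ⟨N₁, N₂, m, π, ⟨e⟩, rfl⟩
    obtain ⟨hdvd, hcard⟩ := quot_aux n c
      (fun x => Subtype.ext (by simpa using hann x.1))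
      (by
        intro J _ w hJ
        obtain ⟨r, hr, hsum⟩ := gens_aux vK vL hcomp (fun i => (w i).1) hJ
        exact ⟨r, hr, Subtype.ext (by simpa using hsum)⟩) N₁ N₂ m π e
    have hle : ∀ i, vL (c : L) ≤ vL (π i : L) := by
      intro i
      obtain ⟨d, hd⟩ := hdvd i
      rw [hd, Subring.coe_mul, map_mul]
      exact mul_le_of_le_one_right' d.2
    have hunit : ∀ i, IsUnit (π i) → vL (π i : L) = 1 := by
      intro i hi
      by_contra h
      exact (Valuation.Integer.not_isUnit_iff_valuation_lt_one.2
        (lt_of_le_of_ne (π i).2 h)) hi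
    rw [Nat.card_eq_fintype_card, Fintype.card_subtype] at hcard
    calc vL (c : L) ^ n ≤ vL (c : L) ^ (Finset.univ.filter fun i => ¬ IsUnit (π i)).card :=
          pow_le_pow_of_le_one zero_le' c.2 hcard
      _ = ∏ i ∈ Finset.univ.filter (fun i => ¬ IsUnit (π i)), vL (c : L) := by
          rw [Finset.prod_const]
      _ ≤ ∏ i ∈ Finset.univ.filter (fun i => ¬ IsUnit (π i)), vL (π i : L) :=
          Finset.prod_le_prod' fun i _ => hle i
      _ = ∏ i, vL (π i : L) := by
          refine Finset.prod_subset (Finset.filter_subset _ _) fun i _ hi => hunit i ?_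
          simpa using hi
end

section
/- Let K be a real-valued field. If 0 → M' → M → M'' → 0 is a short exact sequence of modules over the ring of integers K°, then cont(M) = cont(M')·cont(M''). -/
open scoped NNReal

namespace Cont

section
variable {R : Type*} [CommRing R] (v : R →*₀ ℝ≥0)

/-- ideals are almost principal -/
theorem approx (hv : ∀ a b, v a ≤ v b ↔ b ∣ a) (t : ℝ≥0) (ht : t < 1) (I : Ideal R) :
    ∃ p ∈ I, ∃ q, (∀ x ∈ I, q ∣ x) ∧ t * v q ≤ v p := by
  by_cases h : ∃ p ∈ I, ∀ x ∈ I, v x ≤ v p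
  · obtain ⟨p, hp, h⟩ := h
    exact ⟨p, hp, p, fun x hx => (hv _ _).1 (h x hx), mul_le_of_le_one_left zero_le ht.le⟩
  push Not at h
  have hb : BddAbove (v '' (I : Set R)) := by
    refine ⟨1, ?_⟩
    rintro _ ⟨x, -, rfl⟩
    have := (hv x 1).2 (one_dvd _)
    simpa using this
  have hne : (v '' (I : Set R)).Nonempty := ⟨_, 0, I.zero_mem, rfl⟩
  set s := sSup (v '' (I : Set R)) with hs
  have hle : ∀ x ∈ I, v x ≤ s := fun x hx => le_csSup hb ⟨x, hx, rfl⟩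
  have hex : ∀ r, r < s → ∃ x ∈ I, r < v x := by
    intro r hr
    obtain ⟨_, ⟨x, hx, rfl⟩, h2⟩ := exists_lt_of_lt_csSup hne hr
    exact ⟨x, hx, h2⟩
  have hspos : 0 < s := by
    obtain ⟨x, hx, h2⟩ := h 0 I.zero_mem
    exact lt_of_le_of_lt zero_le (h2.trans_le (hle x hx))
  obtain ⟨y1, hy1, h1⟩ := hex (t * s) (mul_lt_of_lt_one_left hspos ht)
  obtain ⟨y2, hy2, h2⟩ := h y1 hy1
  obtain ⟨e, he⟩ := (hv _ _).1 h2.le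
  have hve : v y1 = v e * v y2 := by rw [he, map_mul, mul_comm]
  have he1 : v e < 1 := by
    by_contra hc
    push Not at hc
    have : v y2 ≤ v e * v y2 := le_mul_of_one_le_left zero_le hc
    exact absurd h2 (not_lt.2 (hve ▸ this))
  have hte : t < v e := by
    have : t * s < v e * s :=
      h1.trans_le (hve ▸ mul_le_mul_of_nonneg_left (hle y2 hy2) zero_le)
    exact lt_of_mul_lt_mul_right this zero_le
  obtain ⟨p, hp, h3⟩ := hex (v e * s) (mul_lt_of_lt_one_left hspos he1)
  by_cases hpe : v p ≤ v e
  · obtain ⟨q, rfl⟩ := (hv _ _).1 hpe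
    refine ⟨_, hp, q, fun x hx => (hv _ _).1 ?_, ?_⟩
    · have : v e * v x < v e * v q := by
        rw [← map_mul v e q]
        exact lt_of_le_of_lt (mul_le_mul_of_nonneg_left (hle x hx) zero_le) h3
      exact (lt_of_mul_lt_mul_left this zero_le).le
    · rw [map_mul]
      exact mul_le_mul_of_nonneg_right hte.le zero_le
  · push Not at hpe
    refine ⟨p, hp, 1, fun x _ => one_dvd _, ?_⟩
    rw [map_one, mul_one]
    exact hte.le.trans hpe.le

/-- colon ideal -/
def col {M : Type*} [AddCommGroup M] [Module R M] (P : Submodule R M) (x : M) : Ideal R :=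
  P.comap (LinearMap.toSpanSingleton R M x)

theorem mem_col {M : Type*} [AddCommGroup M] [Module R M] (P : Submodule R M) (x : M) (b : R) :
    b ∈ col P x ↔ b • x ∈ P := by
  simp [col]

/-- good sequences -/
def good {M : Type*} [AddCommGroup M] [Module R M] : Submodule R M → List (M × R) → Prop
  | _, [] => True
  | P, (p :: l) => (∀ b : R, b • p.1 ∈ P → p.2 ∣ b) ∧ good (P ⊔ R ∙ p.1) l

/-- product -/
def pr {M : Type*} (l : List (M × R)) : ℝ≥0 := (l.map (fun p => v p.2)).prod

/-- span -/
def sp {M : Type*} [AddCommGroup M] [Module R M] (l : List (M × R)) : Submodule R M :=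
  Submodule.span R {x | ∃ p ∈ l, p.1 = x}

variable {M N : Type*} [AddCommGroup M] [Module R M] [AddCommGroup N] [Module R N]

@[simp] theorem pr_nil : pr v ([] : List (M × R)) = 1 := by simp [pr]
@[simp] theorem pr_cons (p : M × R) (l) : pr v (p :: l) = v p.2 * pr v l := by simp [pr]
@[simp] theorem pr_append (l l' : List (M × R)) : pr v (l ++ l') = pr v l * pr v l' := by
  simp [pr]

/-- map a sequence -/
def mp (f : M →ₗ[R] N) (l : List (M × R)) : List (N × R) := l.map (fun p => (f p.1, p.2))

@[simp] theorem pr_mp (f : M →ₗ[R] N) (l) : pr v (mp f l) = pr v l := by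
  simp [pr, mp, Function.comp_def]

theorem good_mono : ∀ (l : List (M × R)) (P Q : Submodule R M), P ≤ Q → good Q l → good P l
  | [], _, _, _, _ => trivial
  | (p :: l), P, Q, h, hg =>
    ⟨fun b hb => hg.1 b (h hb), good_mono l _ _ (sup_le_sup_right h _) hg.2⟩

theorem good_comap (f : M →ₗ[R] N) : ∀ (l : List (M × R)) (P : Submodule R N),
    good P (mp f l) → good (P.comap f) l
  | [], _, _ => trivial
  | (p :: l), P, hg => by
    refine ⟨fun b hb => hg.1 b (by simpa using hb), ?_⟩
    refine good_mono l _ _ ?_ (good_comap f l _ hg.2)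
    refine sup_le (Submodule.comap_mono le_sup_left) ?_
    rw [Submodule.span_singleton_le_iff_mem, Submodule.mem_comap]
    exact Submodule.mem_sup_right (Submodule.mem_span_singleton_self _)

theorem good_map (f : M →ₗ[R] N) : ∀ (l : List (M × R)) (P : Submodule R M),
    LinearMap.ker f ≤ P → good P l → good (P.map f) (mp f l)
  | [], _, _, _ => trivial
  | (p :: l), P, h, hg => by
    refine ⟨fun b hb => hg.1 b ?_, ?_⟩
    · have : b • p.1 ∈ (P.map f).comap f := by simpa using hb
      rwa [Submodule.comap_map_eq, sup_eq_left.2 h] at this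
    · have := good_map f l _ (h.trans le_sup_left) hg.2
      rwa [Submodule.map_sup, Submodule.map_span, Set.image_singleton] at this

theorem good_append : ∀ (l l' : List (M × R)) (P Q : Submodule R M), P ≤ Q →
    (∀ p ∈ l, p.1 ∈ Q) → good P l → good Q l' → good P (l ++ l')
  | [], l', P, Q, h, _, _, h2 => good_mono l' _ _ h h2
  | (p :: l), l', P, Q, h, hq, h1, h2 => by
    refine ⟨h1.1, good_append l l' _ Q ?_ (fun q hq' => hq q (by simp [hq'])) h1.2 h2⟩
    refine sup_le h ?_
    rw [Submodule.span_singleton_le_iff_mem]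
    exact hq p (by simp)

theorem lift_list (f : M →ₗ[R] N) : ∀ (l : List (N × R)), (∀ p ∈ l, p.1 ∈ LinearMap.range f) →
    ∃ l' : List (M × R), mp f l' = l
  | [], _ => ⟨[], rfl⟩
  | (p :: l), h => by
    obtain ⟨l', hl'⟩ := lift_list f l (fun q hq => h q (by simp [hq]))
    obtain ⟨x, hx⟩ := h p (by simp)
    exact ⟨(x, p.2) :: l', by simp only [mp, List.map_cons] at hl' ⊢; rw [hl', hx]⟩

theorem exchange (hv : ∀ a b, v a ≤ v b ↔ b ∣ a) (t : ℝ≥0) (ht : t < 1) (y : M) :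
    ∀ (l : List (M × R)) (P : Submodule R M) (α : R), α • y ∈ P → good P l →
    ∃ l' : List (M × R), l'.length = l.length ∧ good (P ⊔ R ∙ y) l' ∧
      t ^ (2 * l.length) * (v α * pr v l') ≤ pr v l
  | [], P, α, _, _ => ⟨[], rfl, trivial, by
      have := (hv α 1).2 (one_dvd _)
      simpa using this⟩
  | ((x, a) :: l), P, α, hα, hg => by
    obtain ⟨α', hα', b, hb, hbα⟩ := approx v hv t ht (col (P ⊔ R ∙ x) y)
    obtain ⟨β, hβ, a', ha', hab⟩ := approx v hv t ht (col (P ⊔ R ∙ y) x)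
    rw [mem_col] at hα' hβ
    obtain ⟨l', hlen, hgl, hpr⟩ := exchange hv t ht y l (P ⊔ R ∙ x) α' hα' hg.2
    have key : v α * v β ≤ v b * v a := by
      obtain ⟨p, hp, z, hz, hpz⟩ := Submodule.mem_sup.1 hβ
      obtain ⟨γ, rfl⟩ := Submodule.mem_span_singleton.1 hz
      have hx : x ∈ P ⊔ R ∙ x := Submodule.mem_sup_right (Submodule.mem_span_singleton_self _)
      rcases le_total (v α) (v γ) with h | h
      · obtain ⟨δ, rfl⟩ := (hv _ _).1 h
        have h1 : b ∣ γ := by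
          apply hb
          rw [mem_col]
          have : γ • y = β • x - p := by rw [← hpz]; abel
          rw [this]
          exact sub_mem (Submodule.smul_mem _ _ hx) (Submodule.mem_sup_left hp)
        have h2 : a ∣ δ * β := by
          apply hg.1
          show (δ * β) • x ∈ P
          rw [mul_smul, ← hpz, smul_add, smul_smul, mul_comm δ γ]
          exact add_mem (P.smul_mem _ hp) hα
        rw [← map_mul, ← map_mul, hv, mul_assoc]
        exact mul_dvd_mul h1 h2
      · obtain ⟨δ, rfl⟩ := (hv _ _).1 h
        have h1 : b ∣ α := by
          apply hb
          rw [mem_col]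
          exact Submodule.mem_sup_left hα
        have h2 : a ∣ β := by
          apply hg.1
          show β • x ∈ P
          rw [← hpz, mul_comm, mul_smul]
          exact add_mem hp (P.smul_mem _ hα)
        rw [← map_mul, ← map_mul, hv]
        exact mul_dvd_mul h1 h2
    refine ⟨(x, a') :: l', by simp [hlen], ⟨fun c hc => ha' c ((mem_col _ _ _).2 hc), ?_⟩, ?_⟩
    · rwa [sup_right_comm]
    · simp only [List.length_cons, pr_cons]
      calc t ^ (2 * (l.length + 1)) * (v α * (v a' * pr v l'))
          = t ^ (2 * l.length) * t * v α * (t * v a') * pr v l' := by ring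
        _ ≤ t ^ (2 * l.length) * t * v α * v β * pr v l' := by gcongr
        _ = t ^ (2 * l.length) * t * (v α * v β) * pr v l' := by ring
        _ ≤ t ^ (2 * l.length) * t * (v b * v a) * pr v l' := by gcongr
        _ = t ^ (2 * l.length) * (t * v b) * v a * pr v l' := by ring
        _ ≤ t ^ (2 * l.length) * v α' * v a * pr v l' := by gcongr
        _ = v a * (t ^ (2 * l.length) * (v α' * pr v l')) := by ring
        _ ≤ v a * pr v l := by gcongr

theorem split (hv : ∀ a b, v a ≤ v b ↔ b ∣ a) (t : ℝ≥0) (ht0 : 0 < t) (ht : t < 1)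
    (W : Submodule R M) :
    ∀ (l : List (M × R)) (P : Submodule R M), good P l →
    ∃ l' l'' : List (M × R), (∀ p ∈ l', p.1 ∈ W) ∧ good P l' ∧ good (P ⊔ W) l'' ∧
      t ^ l.length * (pr v l' * pr v l'') ≤ pr v l
  | [], P, _ => ⟨[], [], by simp, trivial, trivial, by simp⟩
  | ((x, a) :: l), P, hg => by
    obtain ⟨α, hα, a', ha', hab⟩ := approx v hv t ht (col (P ⊔ W) x)
    rw [mem_col] at hα
    obtain ⟨l', l'', h1, h2, h3, h4⟩ := split hv t ht0 ht W l _ hg.2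
    obtain ⟨p, hp, w, hw, hpw⟩ := Submodule.mem_sup.1 hα
    have hw' : w = α • x - p := by rw [← hpw]; abel
    have hc : ∃ c, (∀ b : R, b • w ∈ P → c ∣ b) ∧ v α * v c ≤ v a := by
      by_cases h : v α ≠ 0 ∧ v a ≤ v α
      · obtain ⟨h0, h⟩ := h
        obtain ⟨c, rfl⟩ := (hv _ _).1 h
        refine ⟨c, fun b hb => ?_, by rw [map_mul]⟩
        have : α * c ∣ b * α := by
          apply hg.1
          show (b * α) • x ∈ P
          have e : (b * α) • x = b • w + b • p := by rw [hw', mul_smul, smul_sub]; abel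
          rw [e]
          exact add_mem hb (P.smul_mem _ hp)
        rw [← hv, map_mul, map_mul, mul_comm] at this
        rw [← hv]
        exact le_of_mul_le_mul_left this (pos_iff_ne_zero.2 h0)
      · refine ⟨1, fun b _ => one_dvd _, ?_⟩
        rw [map_one, mul_one]
        by_cases h0 : v α = 0
        · simp [h0]
        · by_contra h'
          exact h ⟨h0, (not_le.1 h').le⟩
    obtain ⟨c, hc1, hc2⟩ := hc
    refine ⟨(w, c) :: l', (x, a') :: l'', ?_, ⟨hc1, good_mono l' _ _ ?_ h2⟩,
      ⟨fun b hb => ha' b ((mem_col _ _ _).2 hb), ?_⟩, ?_⟩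
    · intro q hq
      rcases List.mem_cons.1 hq with rfl | hq
      · exact hw
      · exact h1 q hq
    · refine sup_le le_sup_left ?_
      rw [Submodule.span_singleton_le_iff_mem]
      show w ∈ _
      rw [hw']
      exact sub_mem (Submodule.smul_mem _ _
        (Submodule.mem_sup_right (Submodule.mem_span_singleton_self _))) (Submodule.mem_sup_left hp)
    · rwa [sup_right_comm]
    · simp only [List.length_cons, pr_cons]
      calc t ^ (l.length + 1) * (v c * pr v l' * (v a' * pr v l''))
          = (t * v a') * v c * (t ^ l.length * (pr v l' * pr v l'')) := by ring
        _ ≤ v α * v c * pr v l := by gcongr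
        _ ≤ v a * pr v l := by gcongr

theorem good_ofFn : ∀ (n : ℕ) (x : Fin n → M) (a : Fin n → R) (P : Submodule R M),
    (∀ j b, b • x j ∈ P ⊔ Submodule.span R (x '' {i | i < j}) → a j ∣ b) →
    good P (List.ofFn fun i => (x i, a i))
  | 0, _, _, _, _ => by simp [good]
  | n + 1, x, a, P, h => by
    rw [List.ofFn_succ]
    refine ⟨fun b hb => h 0 b (Submodule.mem_sup_left hb), ?_⟩
    refine good_ofFn n (fun i => x i.succ) (fun i => a i.succ) _ fun j b hb => h j.succ b ?_
    refine (sup_le (sup_le le_sup_left (le_sup_of_le_right ?_)) (le_sup_of_le_right ?_) :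
      _ ≤ P ⊔ Submodule.span R (x '' {i | i < j.succ})) hb
    · rw [Submodule.span_singleton_le_iff_mem]
      exact Submodule.subset_span ⟨0, by simp, rfl⟩
    · apply Submodule.span_mono
      rintro _ ⟨i, hi, rfl⟩
      exact ⟨i.succ, by simpa using hi, rfl⟩

theorem pr_one_of_subsingleton (hv : ∀ a b, v a ≤ v b ↔ b ∣ a) [Subsingleton M] :
    ∀ (l : List (M × R)) (P : Submodule R M), good P l → pr v l = 1
  | [], _, _ => by simp
  | (p :: l), P, hg => by
    rw [pr_cons, pr_one_of_subsingleton hv l _ hg.2, mul_one]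
    have h : p.2 ∣ 1 := hg.1 1 (by rw [Subsingleton.elim ((1 : R) • p.1) 0]; exact P.zero_mem)
    have h1 := (hv _ _).2 h
    have h2 := (hv p.2 1).2 (one_dvd _)
    rw [le_antisymm h2 h1, map_one]

theorem exists_pivot (hv : ∀ a b, v a ≤ v b ↔ b ∣ a) (t : ℝ≥0) (ht : t < 1)
    (n : ℕ) (L : Submodule R (Fin (n + 1) → R)) :
    ∃ (i : Fin (n + 1)) (l : Fin (n + 1) → R) (q : R), l ∈ L ∧ (∀ j, l i ∣ l j) ∧
      (∀ l' ∈ L, q ∣ l' i) ∧ t * v q ≤ v (l i) := by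
  choose p hp q hq hpq using fun i : Fin (n + 1) =>
    approx v hv t ht (L.map (LinearMap.proj i : (Fin (n + 1) → R) →ₗ[R] R))
  obtain ⟨i, hi⟩ := Finite.exists_max (fun i => v (q i))
  obtain ⟨l, hl, hli⟩ := hp i
  obtain ⟨k, hk⟩ := Finite.exists_max (fun j => v (l j))
  refine ⟨k, l, q i, hl, fun j => (hv _ _).1 (hk j), fun l' hl' => ?_, ?_⟩
  · exact ((hv _ _).1 (hi k)).trans (hq k _ ⟨l', hl', rfl⟩)
  · refine (hpq i).trans ?_
    rw [← hli]
    exact hk i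

theorem diag (hv : ∀ a b, v a ≤ v b ↔ b ∣ a) (t : ℝ≥0) (ht : t < 1) :
    ∀ (n : ℕ) (M : Type*) [AddCommGroup M] [Module R M] (x : Fin n → M)
      (_ : Submodule.span R (Set.range x) = ⊤) (l : List (M × R)) (_ : good ⊥ l),
    ∃ (m : ℕ) (π : Fin m → R) (φ : M →ₗ[R] ((i : Fin m) → R ⧸ Ideal.span {π i})),
      Function.Surjective φ ∧ t ^ (n * (2 * l.length + 1)) * ∏ i, v (π i) ≤ pr v l := by
  intro n
  induction n with
  | zero =>
    intro M _ _ x hx l hl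
    have : Subsingleton M := by
      rw [← Submodule.subsingleton_iff R, ← subsingleton_iff_bot_eq_top, ← hx]
      simp
    refine ⟨0, Fin.elim0, 0, fun y => ⟨0, Subsingleton.elim _ _⟩, ?_⟩
    rw [pr_one_of_subsingleton v hv l _ hl]
    simp
  | succ n ih =>
    intro M _ _ x hx l hl
    set F := Fintype.linearCombination R x with hF
    have hFs : Function.Surjective F := by
      rw [← LinearMap.range_eq_top, hF, Fintype.range_linearCombination, hx]
    obtain ⟨i, r, q, hr, hdiv, hq, htq⟩ := exists_pivot v hv t ht n (LinearMap.ker F)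
    choose a' ha' using hdiv
    set a : Fin (n + 1) → R := Function.update a' i 1 with ha
    have hai : a i = 1 := by simp [ha]
    have hra : r = r i • a := by
      funext j
      by_cases hj : j = i
      · subst hj; simp [hai]
      · simp [ha, hj, ← ha']
    set y := F a with hy
    have hry : r i • y = 0 := by
      rw [hy, ← map_smul, ← hra]; exact hr
    obtain ⟨l', hlen, hgl, hpr⟩ := exchange v hv t ht y l ⊥ (r i) (by simp [hry]) hl
    rw [bot_sup_eq] at hgl
    have hgl2 := good_map (R ∙ y).mkQ l' (R ∙ y) (by simp) hgl
    have hb : (R ∙ y).map (R ∙ y).mkQ = ⊥ := by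
      rw [Submodule.map_span, Set.image_singleton]
      simp
    rw [hb] at hgl2
    have hgen : Submodule.span R (Set.range fun j => (R ∙ y).mkQ (x (i.succAbove j))) = ⊤ := by
      set S := Submodule.span R (Set.range fun j => (R ∙ y).mkQ (x (i.succAbove j))) with hS
      have hmem : ∀ j, (R ∙ y).mkQ (x (i.succAbove j)) ∈ S :=
        fun j => Submodule.subset_span ⟨j, rfl⟩
      have hmi : (R ∙ y).mkQ (x i) ∈ S := by
        have e : y = x i + ∑ j, a (i.succAbove j) • x (i.succAbove j) := by
          rw [hy, hF, Fintype.linearCombination_apply, Fin.sum_univ_succAbove _ i, hai, one_smul]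
        have e2 : (R ∙ y).mkQ y = 0 := by simp
        have e3 : (R ∙ y).mkQ (x i)
            = - ∑ j, a (i.succAbove j) • (R ∙ y).mkQ (x (i.succAbove j)) := by
          have e4 := congrArg (R ∙ y).mkQ e
          rw [e2, map_add, map_sum] at e4
          simp only [map_smul] at e4
          rw [eq_neg_iff_add_eq_zero]
          exact e4.symm
        rw [e3]
        exact neg_mem (sum_mem fun j _ => S.smul_mem _ (hmem j))
      have hall : ∀ j, (R ∙ y).mkQ (x j) ∈ S := by
        intro j
        rcases Fin.eq_self_or_eq_succAbove i j with rfl | ⟨k, rfl⟩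
        · exact hmi
        · exact hmem k
      rw [eq_top_iff]
      have h1 : (⊤ : Submodule R (M ⧸ (R ∙ y))) = (⊤ : Submodule R M).map (R ∙ y).mkQ := by
        rw [Submodule.map_top, Submodule.range_mkQ]
      rw [h1, ← hx, Submodule.map_span, Submodule.span_le]
      rintro _ ⟨_, ⟨j, rfl⟩, rfl⟩
      exact hall j
    obtain ⟨m, π, φ, hφ, hle⟩ := ih (M ⧸ (R ∙ y)) _ hgen _ hgl2
    have hψ : ∃ ψ : M →ₗ[R] R ⧸ Ideal.span {q}, ∀ c, ψ (F c) = Ideal.Quotient.mk _ (c i) := by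
      let ψ0 : (Fin (n + 1) → R) →ₗ[R] R ⧸ Ideal.span {q} :=
        (Submodule.mkQ (Ideal.span {q})).comp (LinearMap.proj i)
      have hk : LinearMap.ker F ≤ LinearMap.ker ψ0 := by
        intro c hc
        rw [LinearMap.mem_ker]
        show Ideal.Quotient.mk (Ideal.span {q}) (c i) = 0
        rw [Ideal.Quotient.eq_zero_iff_mem, Ideal.mem_span_singleton]
        exact hq c hc
      refine ⟨((LinearMap.ker F).liftQ ψ0 hk).comp
        (F.quotKerEquivOfSurjective hFs).symm.toLinearMap, fun c => ?_⟩
      have : (F.quotKerEquivOfSurjective hFs).symm (F c) = Submodule.Quotient.mk c := by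
        rw [LinearEquiv.symm_apply_eq]
        rfl
      simp only [LinearMap.comp_apply, LinearEquiv.coe_coe, this]
      rfl
    obtain ⟨ψ, hψ⟩ := hψ
    refine ⟨m + 1, Fin.cons q π, LinearMap.pi (fun k => Fin.cases
      (motive := fun k => M →ₗ[R] R ⧸ Ideal.span {(Fin.cons q π : Fin (m + 1) → R) k})
      ψ (fun j => (LinearMap.proj j).comp (φ.comp (R ∙ y).mkQ)) k), ?_, ?_⟩
    · intro z
      obtain ⟨w, hw⟩ := hφ (fun j => z j.succ)
      obtain ⟨w, rfl⟩ := (R ∙ y).mkQ_surjective w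
      let z0 : R ⧸ Ideal.span {q} := z 0
      obtain ⟨u, hu⟩ := Ideal.Quotient.mk_surjective (z0 - ψ w)
      refine ⟨w + u • y, ?_⟩
      funext k
      refine Fin.cases ?_ (fun j => ?_) k
      · show ψ (w + u • y) = z0
        rw [map_add, hy, ← map_smul, hψ]
        simp only [Pi.smul_apply, hai, smul_eq_mul, mul_one]
        rw [hu]
        abel
      · show φ ((R ∙ y).mkQ (w + u • y)) j = z j.succ
        have : (R ∙ y).mkQ (u • y) = 0 :=
          (Submodule.Quotient.mk_eq_zero _).2
            (Submodule.smul_mem _ _ (Submodule.mem_span_singleton_self y))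
        rw [map_add, this, add_zero, hw]
    · rw [Fin.prod_univ_succ]
      simp only [Fin.cons_zero, Fin.cons_succ]
      have hlen2 : (mp (R ∙ y).mkQ l').length = l.length := by simp [mp, hlen]
      rw [hlen2, pr_mp] at hle
      calc t ^ ((n + 1) * (2 * l.length + 1)) * (v q * ∏ j, v (π j))
          = t ^ (2 * l.length) * ((t * v q) *
              (t ^ (n * (2 * l.length + 1)) * ∏ j, v (π j))) := by ring
        _ ≤ t ^ (2 * l.length) * (v (r i) * pr v l') := by gcongr
        _ ≤ pr v l := hpr

theorem le_of_forall_pow {A B : ℝ≥0} (k : ℕ) (h : ∀ t : ℝ≥0, 0 < t → t < 1 → t ^ k * A ≤ B) :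
    A ≤ B := by
  have h1 : Filter.Tendsto (fun t : ℝ≥0 => t ^ k * A) (nhdsWithin 1 (Set.Iio 1))
      (nhds ((1 : ℝ≥0) ^ k * A)) := by
    apply Filter.Tendsto.mono_left _ nhdsWithin_le_nhds
    have : Continuous (fun t : ℝ≥0 => t ^ k * A) := by fun_prop
    exact this.tendsto 1
  rw [one_pow, one_mul] at h1
  have hne : (nhdsWithin (1 : ℝ≥0) (Set.Iio 1)).NeBot := nhdsLT_neBot_of_exists_lt ⟨0, one_pos⟩
  refine le_of_tendsto h1 ?_
  filter_upwards [Ioo_mem_nhdsLT (one_pos : (0 : ℝ≥0) < 1)] with t ht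
  exact h t ht.1 ht.2

theorem content_le (hv : ∀ a b, v a ≤ v b ↔ b ∣ a) (l : List (M × R)) (hl : good ⊥ l) :
    content R (fun a => v a) M ≤ pr v l := by
  set x : Fin l.length → M := fun i => (l.get i).1 with hx
  set W := Submodule.span R (Set.range x) with hW
  have hmem : ∀ p ∈ l, p.1 ∈ LinearMap.range W.subtype := by
    intro p hp
    rw [Submodule.range_subtype]
    obtain ⟨i, rfl⟩ := List.get_of_mem hp
    exact Submodule.subset_span ⟨i, rfl⟩
  obtain ⟨l', hll⟩ := lift_list W.subtype l hmem
  rw [← hll] at hl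
  rw [← hll]
  have hgl : good ⊥ l' := good_mono _ _ _ bot_le (good_comap W.subtype l' ⊥ hl)
  rw [pr_mp]
  let x' : Fin l.length → W := fun i => ⟨x i, Submodule.subset_span ⟨i, rfl⟩⟩
  have hx' : Submodule.span R (Set.range x') = ⊤ := by
    have h := Submodule.span_span_coe_preimage (R := R) (s := Set.range x)
    rw [← h]
    congr 1
    ext ⟨z, hz⟩
    simp [x', Subtype.ext_iff]
  refine le_of_forall_pow (l.length * (2 * l'.length + 1)) fun t ht0 ht => ?_
  obtain ⟨m, π, φ, hφ, hle⟩ := diag v hv t ht _ W x' hx' l' hgl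
  refine le_trans ?_ hle
  gcongr
  refine csInf_le (OrderBot.bddBelow _) ⟨W, LinearMap.ker φ, m, π,
    ⟨φ.quotKerEquivOfSurjective hφ⟩, rfl⟩

theorem exists_good (r : ℝ≥0) (hr : ∃ (N₁ : Submodule R M) (N₂ : Submodule R ↥N₁) (n : ℕ)
    (π : Fin n → R),
    Nonempty ((↥N₁ ⧸ N₂) ≃ₗ[R] ((i : Fin n) → R ⧸ Ideal.span {π i})) ∧
    r = ∏ i, v (π i)) : ∃ l : List (M × R), good ⊥ l ∧ pr v l = r := by
  obtain ⟨N₁, N₂, n, π, ⟨e⟩, rfl⟩ := hr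
  let φ : N₁ →ₗ[R] ((i : Fin n) → R ⧸ Ideal.span {π i}) := e.toLinearMap.comp N₂.mkQ
  have hφ : Function.Surjective φ := e.surjective.comp N₂.mkQ_surjective
  choose x hx using fun i : Fin n => hφ (Pi.single i (1 : R ⧸ Ideal.span {π i}))
  have hg : good ⊥ (List.ofFn fun i => (x i, π i)) := by
    apply good_ofFn
    intro j b hb
    rw [bot_sup_eq] at hb
    have hle : Submodule.span R (x '' {i | i < j}) ≤
        LinearMap.ker ((LinearMap.proj j).comp φ) := by
      rw [Submodule.span_le]
      rintro _ ⟨i, hi, rfl⟩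
      have hij : j ≠ i := (ne_of_lt hi).symm
      simp [hx, hij]
    have h0 := hle hb
    rw [LinearMap.mem_ker] at h0
    have h1 : b • (1 : R ⧸ Ideal.span {π j}) = 0 := by
      simpa [hx] using h0
    rw [← Ideal.mem_span_singleton, ← Ideal.Quotient.eq_zero_iff_mem]
    rwa [Algebra.smul_def, mul_one] at h1
  refine ⟨mp N₁.subtype (List.ofFn fun i => (x i, π i)), ?_, ?_⟩
  · have := good_map N₁.subtype _ ⊥ (by simp) hg
    rwa [Submodule.map_bot] at this
  · rw [pr_mp]
    simp [pr, List.map_ofFn, List.prod_ofFn]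

theorem le_content (B : ℝ≥0) (h : ∀ l : List (M × R), good ⊥ l → B ≤ pr v l) :
    B ≤ content R (fun a => v a) M := by
  refine le_csInf ?_ ?_
  · exact ⟨1, ⊥, ⊥, 0, Fin.elim0, ⟨⟨0, 0, fun _ => Subsingleton.elim _ _,
      fun _ => Subsingleton.elim _ _⟩⟩, by simp⟩
  · intro r hr
    obtain ⟨l, hl, rfl⟩ := exists_good v r hr
    exact h l hl

theorem main {M' M'' : Type*} [AddCommGroup M'] [AddCommGroup M''] [Module R M'] [Module R M'']
    (hv : ∀ a b, v a ≤ v b ↔ b ∣ a)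
    (f : M' →ₗ[R] M) (g : M →ₗ[R] M'')
    (hf : Function.Injective f) (hg : Function.Surjective g)
    (hfg : Function.Exact f g) :
    content R (fun a => v a) M
      = content R (fun a => v a) M' * content R (fun a => v a) M'' := by
  have hker : LinearMap.ker g = LinearMap.range f := LinearMap.exact_iff.1 hfg
  apply le_antisymm
  · have h1 : ∀ l' : List (M' × R), good ⊥ l' → ∀ l'' : List (M'' × R), good ⊥ l'' →
        content R (fun a => v a) M ≤ pr v l' * pr v l'' := by
      intro l' hl' l'' hl''
      obtain ⟨k, rfl⟩ := lift_list g l'' (fun p _ => hg p.1)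
      have h2 := good_comap g k ⊥ hl''
      have h3 := good_map f l' ⊥ (by rw [LinearMap.ker_eq_bot.2 hf]) hl'
      rw [Submodule.map_bot] at h3
      have h4 := good_append (mp f l') k ⊥ _ bot_le ?_ h3 h2
      · have := content_le v hv _ h4
        simpa using this
      · intro p hp
        obtain ⟨q, hq, rfl⟩ := List.mem_map.1 hp
        show g (f q.1) ∈ (⊥ : Submodule R M'')
        rw [Submodule.mem_bot]
        exact hfg.apply_apply_eq_zero _
    by_contra hc
    push Not at hc
    have hc1 : content R (fun a => v a) M' * content R (fun a => v a) M'' ≥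
        content R (fun a => v a) M := by
      by_cases h0 : content R (fun a => v a) M = 0
      · rw [h0]; exact zero_le
      have h5 : ∀ l' : List (M' × R), good ⊥ l' →
          content R (fun a => v a) M ≤ pr v l' * content R (fun a => v a) M'' := by
        intro l' hl'
        have hp : 0 < pr v l' := by
          rw [pos_iff_ne_zero]
          intro h
          have := h1 l' hl' [] trivial
          rw [h, zero_mul] at this
          exact h0 (le_antisymm this zero_le)
        rw [← div_le_iff₀' hp]
        refine le_content v _ fun l'' hl'' => ?_
        rw [div_le_iff₀' hp]
        exact h1 l' hl' l'' hl''
      have hp : 0 < content R (fun a => v a) M'' := by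
        rw [pos_iff_ne_zero]
        intro h
        have := h5 [] trivial
        rw [h, mul_zero] at this
        exact h0 (le_antisymm this zero_le)
      show _ ≤ _
      rw [← div_le_iff₀ hp]
      refine le_content v _ fun l' hl' => ?_
      rw [div_le_iff₀ hp]
      exact h5 l' hl'
    exact absurd hc (not_lt.2 hc1)
  · refine le_content v _ fun l hl => ?_
    refine le_of_forall_pow l.length fun t ht0 ht => ?_
    obtain ⟨l', l'', h1, h2, h3, h4⟩ := split v hv t ht0 ht (LinearMap.range f) l ⊥ hl
    refine le_trans ?_ h4
    obtain ⟨k, rfl⟩ := lift_list f l' h1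
    have h5 : good ⊥ k := good_mono _ _ _ bot_le (good_comap f k ⊥ h2)
    rw [bot_sup_eq, ← hker] at h3
    have h6 := good_map g l'' _ le_rfl h3
    have h7 : good ⊥ (mp g l'') := good_mono _ _ _ bot_le h6
    have h8 := content_le v hv _ h5
    have h9 := content_le v hv _ h7
    rw [pr_mp] at h9 ⊢
    gcongr

end
end Cont

/-- For a real-valued field `K` and a short exact sequence `0 → M' → M → M'' → 0` of
`K°`-modules, the content is multiplicative: `cont(M) = cont(M') · cont(M'')`. -/
theorem content_multiplicative_of_shortExact
    {K : Type*} [Field K] (vK : Valuation K ℝ≥0)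
    {M' M M'' : Type*} [AddCommGroup M'] [AddCommGroup M] [AddCommGroup M'']
    [Module ↥vK.integer M'] [Module ↥vK.integer M] [Module ↥vK.integer M'']
    (f : M' →ₗ[↥vK.integer] M) (g : M →ₗ[↥vK.integer] M'')
    (hf : Function.Injective f) (hg : Function.Surjective g)
    (hfg : Function.Exact f g) :
    content ↥vK.integer (fun a => vK ↑a) M
      = content ↥vK.integer (fun a => vK ↑a) M' * content ↥vK.integer (fun a => vK ↑a) M'' := by
  exact Cont.main (vK.toMonoidWithZeroHom.comp vK.integer.subtype.toMonoidWithZeroHom)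
    (fun a b => (Valuation.integer.integers vK).dvd_iff_le.symm) f g hf hg hfg
end

section
/- Let V be a finite-dimensional vector space over a real-valued field K and let L ⊆ M be two bounded semilattices of V. Then the index and the content are related by [M : L] = cont(M/L)^{-1}. -/
open scoped NNReal

set_option synthInstance.maxHeartbeats 400000
set_option maxHeartbeats 1000000

/-- A `K°`-submodule `M` of a `K`-vector space `V` is a semilattice if it spans `V` over `K`. -/
def IsSemilattice {K V : Type*} [Field K] [AddCommGroup V] [Module K V]
    (vK : Valuation K ℝ≥0) (M : Submodule ↥vK.integer V) : Prop :=
  Submodule.span K (M : Set V) = ⊤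

/-- A semilattice is bounded if it is contained in a lattice, i.e. in a free `K°`-submodule
spanning `V`. -/
def IsBoundedSemilattice {K V : Type*} [Field K] [AddCommGroup V] [Module K V]
    (vK : Valuation K ℝ≥0) (M : Submodule ↥vK.integer V) : Prop :=
  IsSemilattice vK M ∧ ∃ N : Submodule ↥vK.integer V,
    M ≤ N ∧ Module.Free ↥vK.integer ↥N ∧ IsSemilattice vK N

/-- The determinant of a `K°`-submodule `M` of an `n`-dimensional `K`-vector space `V`: the
`K°`-submodule of the top exterior power (viewed inside the exterior algebra of `V`) generated
by the wedges `m₁ ∧ ⋯ ∧ mₙ` of elements of `M`. -/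
noncomputable def detSubmodule {K V : Type*} [Field K] [AddCommGroup V] [Module K V]
    (vK : Valuation K ℝ≥0) (n : ℕ) (M : Submodule ↥vK.integer V) :
    Submodule ↥vK.integer (ExteriorAlgebra K V) :=
  Submodule.span ↥vK.integer
    {x | ∃ m : Fin n → V, (∀ i, m i ∈ M) ∧ x = ExteriorAlgebra.ιMulti K n m}

/-- The index `[M : L]` of two bounded semilattices `L ⊆ M`:
`sup {|π| : π ∈ K, π · det(L) ⊆ det(M)}`. -/
noncomputable def semilatticeIndex {K V : Type*} [Field K] [AddCommGroup V] [Module K V]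
    (vK : Valuation K ℝ≥0) (n : ℕ) (M L : Submodule ↥vK.integer V) : ℝ≥0 :=
  sSup { r | ∃ π : K, vK π = r ∧
    ∀ x ∈ detSubmodule vK n L, π • x ∈ detSubmodule vK n M }

section helpers
variable {K V : Type*} [Field K] [AddCommGroup V] [Module K V] (vK : Valuation K ℝ≥0)

lemma ex_pi (A : Set K) (C : ℝ≥0) (hb : ∀ a ∈ A, vK a ≤ C) (hne : ∃ a ∈ A, a ≠ 0)
    (t : ℝ≥0) (ht : t < 1) :
    ∃ x ∈ A, ∃ p : K, p ≠ 0 ∧ t * vK p ≤ vK x ∧ ∀ a ∈ A, vK a ≤ vK p := by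
  obtain ⟨a0, ha0, ha0'⟩ := hne
  by_cases h : ∃ x ∈ A, ∀ a ∈ A, vK a ≤ vK x
  · obtain ⟨x, hx, hx'⟩ := h
    refine ⟨x, hx, x, ?_, mul_le_of_le_one_left (zero_le) ht.le, hx'⟩
    rintro rfl
    have := hx' a0 ha0
    simp [ha0'] at this
  · push Not at h
    have hbdd : BddAbove (vK '' A) := ⟨C, by rintro _ ⟨a, ha, rfl⟩; exact hb a ha⟩
    set c := sSup (vK '' A) with hc
    have hle : ∀ a ∈ A, vK a ≤ c := fun a ha => le_csSup hbdd ⟨a, ha, rfl⟩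
    have hcpos : 0 < c := lt_of_lt_of_le (by simpa [pos_iff_ne_zero] using ha0') (hle a0 ha0)
    have htc : t * c < c := by
      calc t * c < 1 * c := by gcongr
        _ = c := one_mul c
    obtain ⟨_, ⟨x1, hx1, rfl⟩, h1⟩ := exists_lt_of_lt_csSup (Set.Nonempty.image vK ⟨a0, ha0⟩) htc
    obtain ⟨x2, hx2, h2⟩ := h x1 hx1
    have p1 : 0 < vK x1 := lt_of_le_of_lt zero_le h1
    have p2 : 0 < vK x2 := lt_trans p1 h2
    have hy : 1 < vK x2 / vK x1 := (one_lt_div p1).2 h2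
    obtain ⟨k, hk1, hk2⟩ := exists_nat_pow_near ((one_le_div p2).2 (hle x2 hx2)) hy
    rw [le_div_iff₀ p2] at hk1
    rw [div_lt_iff₀ p2] at hk2
    have hp : vK ((x2 / x1) ^ (k+1) * x2) = (vK x2 / vK x1) ^ (k+1) * vK x2 := by simp
    refine ⟨x2, hx2, (x2 / x1) ^ (k+1) * x2, ?_, ?_, ?_⟩
    · rw [← vK.ne_zero_iff, hp]
      exact (lt_trans hcpos hk2).ne'
    · rw [hp]
      calc t * ((vK x2 / vK x1) ^ (k+1) * vK x2)
          = t * (((vK x2 / vK x1) ^ k * vK x2)) * (vK x2 / vK x1) := by ring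
        _ ≤ t * c * (vK x2 / vK x1) := by gcongr
        _ ≤ vK x1 * (vK x2 / vK x1) := by gcongr
        _ = vK x2 := mul_div_cancel₀ _ p1.ne'
    · intro a ha
      rw [hp]
      exact (hle a ha).trans hk2.le

/-- integral coordinates give integral determinant -/
lemma det_le_one {n : ℕ} (B : Module.Basis (Fin n) K V) (m : Fin n → V)
    (h : ∀ i j, vK (B.repr (m i) j) ≤ 1) : vK (B.det m) ≤ 1 := by
  rw [Module.Basis.det_apply]
  have : B.toMatrix m = (algebraMap vK.integer K).mapMatrix
      (Matrix.of fun j i => (⟨B.repr (m i) j, h i j⟩ : vK.integer)) := by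
    ext i j
    simp [Module.Basis.toMatrix_apply]
    rfl
  rw [this, ← RingHom.map_det]
  exact (Matrix.det _ : vK.integer).2

lemma exists_good_basis [FiniteDimensional K V] (M : Submodule vK.integer V)
    (hM : IsBoundedSemilattice vK M) :
    ∃ B : Module.Basis (Fin (Module.finrank K V)) K V,
      ∀ m : Fin (Module.finrank K V) → V, (∀ i, m i ∈ M) → vK (B.det m) ≤ 1 := by
  obtain ⟨-, N, hMN, hfree, hN⟩ := hM
  let c := Module.Free.chooseBasis vK.integer N
  have hli : LinearIndependent K (fun i => (c i : V)) := by
    rw [← LinearIndependent.iff_fractionRing vK.integer K]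
    exact c.linearIndependent.map' N.subtype (by simp)
  have hspan : ∀ m ∈ N, m ∈ Submodule.span vK.integer (Set.range (fun i => (c i : V))) := by
    intro m hm
    have := c.mem_span ⟨m, hm⟩
    have h2 := Submodule.mem_map_of_mem (f := N.subtype) this
    rw [Submodule.map_span, ← Set.range_comp] at h2
    exact h2
  have htop : ⊤ ≤ Submodule.span K (Set.range (fun i => (c i : V))) := by
    rw [← show _ = ⊤ from hN, Submodule.span_le]
    intro m hm
    exact Submodule.span_le_restrictScalars vK.integer K _ (hspan m hm)
  let B0 := Module.Basis.mk hli htop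
  have : Finite (Module.Free.ChooseBasisIndex vK.integer N) := Module.Finite.finite_basis B0
  have := Fintype.ofFinite (Module.Free.ChooseBasisIndex vK.integer N)
  let e : Module.Free.ChooseBasisIndex vK.integer N ≃ Fin (Module.finrank K V) :=
    Fintype.equivFinOfCardEq (Module.finrank_eq_card_basis B0).symm
  refine ⟨B0.reindex e, fun m hm => det_le_one vK _ m ?_⟩
  intro i
  have key : ∀ v ∈ Submodule.span vK.integer (Set.range (fun i => (c i : V))),
      ∀ j, vK ((B0.reindex e).repr v j) ≤ 1 := by
    intro v hv
    induction hv using Submodule.span_induction with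
    | mem x hx =>
      obtain ⟨k, rfl⟩ := hx
      intro j
      have : (c k : V) = B0 k := by simp [B0]
      simp only [this, Module.Basis.repr_reindex_apply, Module.Basis.repr_self]
      rw [Finsupp.single_apply]
      split_ifs <;> simp
    | zero => simp
    | add x y _ _ hx hy =>
      intro j
      rw [map_add, Finsupp.add_apply]
      exact (vK.map_add _ _).trans (max_le (hx j) (hy j))
    | smul a x _ hx =>
      intro j
      have : a • x = (a : K) • x := rfl
      rw [this, map_smul, Finsupp.smul_apply, smul_eq_mul, map_mul]
      exact mul_le_one' a.2 (hx j)
  exact key _ (hspan _ (hMN (hm i)))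

lemma exists_det_ne [FiniteDimensional K V] (B : Module.Basis (Fin (Module.finrank K V)) K V)
    (L : Submodule vK.integer V) (hL : IsSemilattice vK L) :
    ∃ m : Fin (Module.finrank K V) → V, (∀ i, m i ∈ L) ∧ B.det m ≠ 0 := by
  obtain ⟨f, hf1, hf2, hf3⟩ := Submodule.exists_fun_fin_finrank_span_eq K (L : Set V)
  unfold IsSemilattice at hL
  have hd : Module.finrank K (Submodule.span K (L : Set V)) = Module.finrank K V := by
    rw [hL]; exact finrank_top K V
  replace hf2 := hf2.trans hL
  let f' : Fin (Module.finrank K V) → V := f ∘ Fin.cast hd.symm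
  refine ⟨f', fun i => hf1 _, ?_⟩
  have h1 : LinearIndependent K f' := hf3.comp _ (Fin.cast_injective _)
  have h2 : Submodule.span K (Set.range f') = ⊤ := by
    rw [← hf2]
    congr 1
    exact (finCongr hd.symm).surjective.range_comp f
  exact (B.is_basis_iff_det.1 ⟨h1, h2⟩).ne_zero

lemma integer_smul_eq (x : ExteriorAlgebra K V) (a : vK.integer) :
    (a : K) • x = (inferInstance : Module vK.integer (ExteriorAlgebra K V)).toSMul.smul a x :=
  algebraMap_smul K a x

lemma smul_det_iff {n : ℕ} (B : Module.Basis (Fin n) K V) (M L : Submodule vK.integer V) (p : K) :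
    (∀ x ∈ detSubmodule vK n L, p • x ∈ detSubmodule vK n M) ↔
    ∀ l : Fin n → V, (∀ i, l i ∈ L) → ∃ m : Fin n → V, (∀ i, m i ∈ M) ∧
      vK p * vK (B.det l) ≤ vK (B.det m) := by
  have hω : ∀ m : Fin n → V, ExteriorAlgebra.ιMulti K n m
      = B.det m • ExteriorAlgebra.ιMulti K n B := by
    have : ExteriorAlgebra.ιMulti K n (M := V) =
      (LinearMap.toSpanSingleton K _ (ExteriorAlgebra.ιMulti K n B)).compAlternatingMap B.det := by
      apply Module.Basis.ext_alternating B
      intro v hv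
      let σ : Equiv.Perm (Fin n) := Equiv.ofBijective v (Finite.injective_iff_bijective.1 hv)
      have h1 : (fun i => B (v i)) = B ∘ σ := rfl
      rw [h1, AlternatingMap.map_perm, AlternatingMap.map_perm]
      simp [B.det_self]
    intro m
    conv_lhs => rw [this]
    simp
  let lam : ExteriorAlgebra K V →ₗ[K] K :=
    ExteriorAlgebra.liftAlternating (fun i => if h : i = n then h ▸ B.det else 0)
  have hlam : ∀ m : Fin n → V, lam (ExteriorAlgebra.ιMulti K n m) = B.det m := by
    intro m
    simp [lam, ExteriorAlgebra.liftAlternating_apply_ιMulti]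
  constructor
  · intro h l hl
    have h1 := h _ (Submodule.subset_span ⟨l, hl, rfl⟩)
    have h2 : ∀ x ∈ detSubmodule vK n M, ∃ m : Fin n → V, (∀ i, m i ∈ M) ∧
        vK (lam x) ≤ vK (B.det m) := by
      intro x hx
      induction hx using Submodule.span_induction with
      | mem x hx =>
        obtain ⟨m, hm, rfl⟩ := hx
        exact ⟨m, hm, by rw [hlam]⟩
      | zero => exact ⟨0, fun _ => M.zero_mem, by simp⟩
      | add x y _ _ hx hy =>
        obtain ⟨m, hm, h3⟩ := hx
        obtain ⟨m', hm', h3'⟩ := hy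
        rw [map_add]
        rcases le_total (vK (B.det m)) (vK (B.det m')) with h | h
        · exact ⟨m', hm', (vK.map_add _ _).trans (max_le (h3.trans h) h3')⟩
        · exact ⟨m, hm, (vK.map_add _ _).trans (max_le h3 (h3'.trans h))⟩
      | smul a x _ hx =>
        obtain ⟨m, hm, h3⟩ := hx
        refine ⟨m, hm, ?_⟩
        refine (congrArg (fun y => vK (lam y)) (integer_smul_eq vK x a)).symm.trans_le ?_
        simp only [map_smul, smul_eq_mul, map_mul]
        exact (mul_le_of_le_one_left zero_le a.2).trans h3
    obtain ⟨m, hm, h3⟩ := h2 _ h1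
    rw [map_smul, hlam, smul_eq_mul, map_mul] at h3
    exact ⟨m, hm, h3⟩
  · intro h x hx
    induction hx using Submodule.span_induction with
    | mem x hx =>
      obtain ⟨l, hl, rfl⟩ := hx
      obtain ⟨m, hm, h3⟩ := h l hl
      rw [hω l, smul_smul]
      by_cases h0 : B.det m = 0
      · have : p * B.det l = 0 := by
          rw [← vK.zero_iff]
          simpa [h0] using h3
        rw [this, zero_smul]; exact Submodule.zero_mem _
      · have h4 : vK (p * B.det l / B.det m) ≤ 1 := by
          rw [map_div₀, map_mul]
          exact div_le_one_of_le₀ h3 zero_le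
        have h5 : (p * B.det l) • ExteriorAlgebra.ιMulti K n B
          = (⟨_, h4⟩ : vK.integer) • ExteriorAlgebra.ιMulti K n m := by
          rw [hω m]
          refine Eq.trans ?_ (integer_smul_eq vK _ _)
          rw [smul_smul, div_mul_cancel₀ _ h0]
        rw [h5]
        exact Submodule.smul_mem _ _ (Submodule.subset_span ⟨m, hm, rfl⟩)
    | zero => simp
    | add x y _ _ hx hy => rw [smul_add]; exact Submodule.add_mem _ hx hy
    | smul a x _ hx =>
      rw [smul_comm]; exact Submodule.smul_mem _ _ hx

lemma cyclic_chain {n : ℕ} (B : Module.Basis (Fin n) K V) {X : Type*} [AddCommGroup X]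
    [Module vK.integer X] (j : X →ₗ[vK.integer] V) (hj : Function.Injective j)
    {k : ℕ} (π : Fin k → vK.integer)
    (φ : X →ₗ[vK.integer] ((i : Fin k) → vK.integer ⧸ Ideal.span {π i}))
    (hφ : Function.Surjective φ) (S : Finset (Fin k)) :
    ∀ x : Fin n → X, (∀ a, ∀ i ∈ S, φ (x a) i = 0) →
      ∃ y : Fin n → X, vK (B.det (j ∘ x)) ≤ (∏ i ∈ S, vK (π i : K)) * vK (B.det (j ∘ y)) := by
  induction S using Finset.induction_on with
  | empty => intro x _; exact ⟨x, by simp⟩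
  | insert i0 S hi0 ih =>
    intro x hx
    by_cases h0 : B.det (j ∘ x) = 0
    · exact ⟨x, by simp [h0]⟩
    obtain ⟨e, he⟩ := hφ (Pi.single i0 1)
    have hxS : ∀ a, ∀ i ∈ S, φ (x a) i = 0 := fun a i hi => hx a i (Finset.mem_insert_of_mem hi)
    have heS : ∀ i ∈ S, φ e i = 0 := by
      intro i hi
      rw [he, Pi.single_eq_of_ne]
      rintro rfl; exact hi0 hi
    -- it suffices to find x' in the larger module
    suffices h : ∃ x' : Fin n → X, (∀ a, ∀ i ∈ S, φ (x' a) i = 0) ∧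
        vK (B.det (j ∘ x)) ≤ vK (π i0 : K) * vK (B.det (j ∘ x')) by
      obtain ⟨x', hx', h1⟩ := h
      obtain ⟨y, hy⟩ := ih x' hx'
      refine ⟨y, h1.trans ?_⟩
      rw [Finset.prod_insert hi0, mul_assoc]
      gcongr
    have key : ∀ a : vK.integer, φ (a • e) i0 = 0 → vK (a : K) ≤ vK (π i0 : K) := by
      intro a ha
      rw [map_smul, he, Pi.smul_apply, Pi.single_eq_same] at ha
      have h1 : (Ideal.Quotient.mk (Ideal.span {π i0}) a) = 0 := by
        rw [← ha, Algebra.smul_def, mul_one]; rfl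
      rw [Ideal.Quotient.eq_zero_iff_mem, Ideal.mem_span_singleton] at h1
      obtain ⟨c, rfl⟩ := h1
      simpa using mul_le_of_le_one_right zero_le c.2
    obtain ⟨hli, hsp⟩ := B.is_basis_iff_det.2 (isUnit_iff_ne_zero.2 h0)
    let B' := Module.Basis.mk hli hsp.ge
    have hB' : ∀ i, B' i = j (x i) := by intro i; simp [B']
    have hsum : j e = ∑ i, B'.repr (j e) i • j (x i) := by
      conv_lhs => rw [← B'.sum_repr (j e)]
      simp [hB']
    set c := B'.repr (j e) with hc
    by_cases hsmall : ∀ i, vK (c i) ≤ 1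
    · refine ⟨x, hxS, ?_⟩
      have h1 : e = ∑ i, (⟨c i, hsmall i⟩ : vK.integer) • x i := by
        apply hj
        rw [map_sum, hsum]
        refine Finset.sum_congr rfl fun i _ => ?_
        rw [map_smul]; rfl
      have h2 : φ ((1 : vK.integer) • e) i0 = 0 := by
        rw [one_smul, h1, map_sum, Finset.sum_apply]
        refine Finset.sum_eq_zero fun i _ => ?_
        rw [map_smul, Pi.smul_apply, hx i i0 (Finset.mem_insert_self _ _), smul_zero]
      have h3 := key 1 h2
      rw [OneMemClass.coe_one, map_one] at h3
      exact le_mul_of_one_le_left zero_le h3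
    · push Not at hsmall
      obtain ⟨i1, hi1⟩ := hsmall
      obtain ⟨q, -, hq⟩ := Finset.exists_max_image Finset.univ (fun i => vK (c i)) ⟨i1, Finset.mem_univ _⟩
      have hq1 : 1 < vK (c q) := hi1.trans_le (hq i1 (Finset.mem_univ _))
      have hq0 : c q ≠ 0 := by rw [← vK.ne_zero_iff]; exact (zero_lt_one.trans hq1).ne'
      have hinv : vK (c q)⁻¹ ≤ 1 := by
        rw [map_inv₀]; exact inv_le_one_of_one_le₀ hq1.le
      have hratio : ∀ i, vK ((c q)⁻¹ * c i) ≤ 1 := by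
        intro i
        rw [map_mul, map_inv₀, inv_mul_le_one₀ (zero_lt_one.trans hq1)]
        exact hq i (Finset.mem_univ _)
      have h1 : (⟨_, hinv⟩ : vK.integer) • e = ∑ i, (⟨_, hratio i⟩ : vK.integer) • x i := by
        apply hj
        rw [map_sum, map_smul]
        change (c q)⁻¹ • j e = _
        rw [hsum, Finset.smul_sum]
        refine Finset.sum_congr rfl fun i _ => ?_
        rw [map_smul, smul_smul]; rfl
      have h2 : φ ((⟨_, hinv⟩ : vK.integer) • e) i0 = 0 := by
        rw [h1, map_sum, Finset.sum_apply]
        refine Finset.sum_eq_zero fun i _ => ?_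
        rw [map_smul, Pi.smul_apply, hx i i0 (Finset.mem_insert_self _ _), smul_zero]
      have h3 := key _ h2
      refine ⟨Function.update x q e, ?_, ?_⟩
      · intro a i hi
        by_cases haq : a = q
        · subst haq; simpa using heS i hi
        · simpa [haq] using hxS a i hi
      · have h4 : B.det (j ∘ Function.update x q e) = c q * B.det (j ∘ x) := by
          rw [Function.comp_update, hsum, AlternatingMap.map_update_sum]
          rw [Finset.sum_eq_single q]
          · rw [AlternatingMap.map_update_smul]
            congr 2
            exact Function.update_eq_self q (j ∘ x)
          · intro i _ hi
            rw [AlternatingMap.map_update_smul]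
            have := B.det.map_update_self (j ∘ x) (i := q) (j := i) hi.symm
            simp only [Function.comp_apply] at this
            rw [this, smul_zero]
          · simp
        rw [h4, map_mul]
        have h3' : vK (c q)⁻¹ ≤ vK (π i0 : K) := h3
        calc vK (B.det (j ∘ x)) = vK (c q)⁻¹ * (vK (c q) * vK (B.det (j ∘ x))) := by
              rw [← mul_assoc, ← map_mul, inv_mul_cancel₀ hq0, map_one, one_mul]
          _ ≤ _ := by gcongr

lemma smith_step {n : ℕ} (D : V [⋀^Fin n]→ₗ[K] K) (M0 L0 : Submodule vK.integer V)
    (b : Module.Basis (Fin n) K V) (hbM : ∀ i, b i ∈ M0)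
    (hbL : ∀ v ∈ L0, ∀ i, vK (b.repr v i) ≤ 1)
    (hsp : Submodule.span K (L0 : Set V) = ⊤) (t : ℝ≥0) (ht0 : 0 < t) (ht : t < 1) (k : ℕ) (hk : k ≤ n) :
    ∃ (S : Finset (Fin n)) (b' : Module.Basis (Fin n) K V) (w : Fin n → V)
      (π : Fin n → vK.integer), S.card = k ∧ (∀ i, b' i ∈ M0) ∧
      (∀ v ∈ L0, ∀ i, vK (b'.repr v i) ≤ 1) ∧
      (∀ v ∈ L0, ∀ i ∈ S, vK (b'.repr v i) ≤ vK (π i : K)) ∧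
      (∀ i ∈ S, w i ∈ L0) ∧ (∀ i, i ∉ S → w i = b' i) ∧
      (∀ i ∈ S, b' i ∈ Submodule.span K (w '' S)) ∧
      t ^ k * (∏ i ∈ S, vK (π i : K)) * vK (D b) ≤ vK (D w) := by
  induction k with
  | zero =>
    exact ⟨∅, b, b, 1, rfl, hbM, hbL, by simp, by simp, by simp, by simp, by simp⟩
  | succ k ih =>
    obtain ⟨S, b', w, π, hS, hM, hL1, hLS, hwL, hwb, hspan, hD⟩ := ih (by omega)
    obtain ⟨i1, hi1⟩ : ∃ i, i ∉ S := by
      by_contra! h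
      have : S = Finset.univ := Finset.eq_univ_iff_forall.2 h
      rw [this, Finset.card_univ, Fintype.card_fin] at hS
      omega
    obtain ⟨x, ⟨l, hl, i2, hi2, rfl⟩, p, hp0, hpx, hpA⟩ := ex_pi vK
      {x : K | ∃ v ∈ L0, ∃ i, i ∉ S ∧ b'.repr v i = x} 1
      (by rintro _ ⟨v, hv, i, -, rfl⟩; exact hL1 v hv i)
      (by
        by_contra! h
        have h1 : b'.coord i1 = 0 := by
          apply LinearMap.ext_on hsp
          intro v hv
          simpa using h _ ⟨v, hv, i1, hi1, rfl⟩
        have h2 := congrArg (fun g => g (b' i1)) h1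
        simp at h2) t ht
    obtain ⟨q, hq0, hqp, hqA⟩ : ∃ q : vK.integer, vK (q : K) ≠ 0 ∧ vK (q : K) ≤ vK p ∧
        ∀ v ∈ L0, ∀ i, i ∉ S → vK (b'.repr v i) ≤ vK (q : K) := by
      by_cases hp1 : vK p ≤ 1
      · exact ⟨⟨p, hp1⟩, by simpa using hp0, le_rfl, fun v hv i hi => hpA _ ⟨v, hv, i, hi, rfl⟩⟩
      · exact ⟨1, by simp, by simpa using (not_le.1 hp1).le,
          fun v hv i hi => by simpa using hL1 v hv i⟩
    obtain ⟨i0, hi0S, hi0⟩ := Finset.exists_max_image Sᶜ (fun i => vK (b'.repr l i))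
      ⟨i2, by simpa using hi2⟩
    rw [Finset.mem_compl] at hi0S
    have htx : t * vK (q : K) ≤ vK (b'.repr l i0) :=
      ((mul_le_mul_right hqp t).trans hpx).trans (hi0 i2 (by simpa using hi2))
    set f := b'.repr l with hf
    have hf0 : f i0 ≠ 0 := by
      intro h0
      rw [h0, map_zero] at htx
      exact (mul_pos ht0 (pos_iff_ne_zero.2 hq0)).not_ge htx
    let r : Fin n → K := fun i => if i ∈ S ∨ i = i0 then 0 else f i / f i0
    have hr1 : ∀ i, vK (r i) ≤ 1 := by
      intro i
      by_cases h : i ∈ S ∨ i = i0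
      · simp [r, h]
      · simp only [r, h, if_false, map_div₀]
        push Not at h
        exact div_le_one_of_le₀ (hi0 i (by simpa using h.1)) zero_le
    let u : V := ∑ i, r i • b' i
    have hu : ∀ i, b'.repr u i = r i := fun i => by
      have := b'.repr_sum_self r
      exact congrFun this i
    have huM : u ∈ M0 := Submodule.sum_mem _ fun i _ =>
      M0.smul_mem (⟨r i, hr1 i⟩ : vK.integer) (hM i)
    have hfu : b'.coord i0 u = 0 := by simp [hu, r]
    let e := LinearEquiv.transvection hfu
    have he : ∀ v, e v = v + b'.repr v i0 • u := fun v => by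
      rw [LinearEquiv.transvection.apply hfu]; rfl
    have hes : ∀ v, e.symm v = v - b'.repr v i0 • u := fun v => by
      rw [LinearEquiv.symm_apply_eq, he]
      simp [hu, r]
    let b'' := b'.map e
    have hb0 : b'' i0 = b' i0 + u := by simp [b'', he]
    have hbi : ∀ i, i ≠ i0 → b'' i = b' i := fun i hi => by
      simp [b'', he, Finsupp.single_apply, hi]
    have hrep : ∀ v i, b''.repr v i = b'.repr v i - b'.repr v i0 * r i := fun v i => by
      simp [b'', hes, hu]
    have hnin : ∀ i ∈ S, i ≠ i0 := by rintro i hi rfl; exact hi0S hi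
    have hDw : D (Function.update w i0 l) = f i0 * D w := by
      have hsum : l = ∑ i, f i • b' i := (b'.sum_repr l).symm
      rw [hsum, AlternatingMap.map_update_sum, Finset.sum_eq_single i0]
      · rw [AlternatingMap.map_update_smul, ← hwb i0 hi0S, Function.update_eq_self, smul_eq_mul]
      · intro i _ hi
        rw [AlternatingMap.map_update_smul]
        suffices h : D (Function.update w i0 (b' i)) = 0 by rw [h, smul_zero]
        by_cases hiS : i ∈ S
        · have h1 : Submodule.span K (w '' S) ≤
              LinearMap.ker (D.toMultilinearMap.toLinearMap w i0) := by
            rw [Submodule.span_le]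
            rintro _ ⟨a, ha, rfl⟩
            exact D.map_update_self w (hnin a ha).symm
          exact h1 (hspan i hiS)
        · rw [← hwb i hiS]
          exact D.map_update_self w hi.symm
      · simp
    have hwimg : w '' S ⊆ Function.update w i0 l '' (insert i0 S : Finset (Fin n)) := by
      rintro _ ⟨a, ha, rfl⟩
      exact ⟨a, by simpa using Or.inr ha, by simp [hnin a ha]⟩
    refine ⟨insert i0 S, b'', Function.update w i0 l, Function.update π i0 q, ?_, ?_, ?_, ?_, ?_,
      ?_, ?_, ?_⟩
    · rw [Finset.card_insert_of_notMem hi0S, hS]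
    · intro i
      by_cases hi : i = i0
      · subst hi; rw [hb0]; exact M0.add_mem (hM _) huM
      · rw [hbi i hi]; exact hM i
    · intro v hv i
      rw [hrep]
      refine (vK.map_sub _ _).trans (max_le (hL1 v hv i) ?_)
      rw [map_mul]
      exact mul_le_one' (hL1 v hv i0) (hr1 i)
    · intro v hv i hi
      rw [hrep]
      rcases Finset.mem_insert.1 hi with rfl | hi
      · simpa [r] using hqA v hv i hi0S
      · simpa [r, hi, hnin i hi] using hLS v hv i hi
    · intro i hi
      rcases Finset.mem_insert.1 hi with rfl | hi
      · simpa using hl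
      · simpa [hnin i hi] using hwL i hi
    · intro i hi
      rw [Finset.mem_insert, not_or] at hi
      rw [hbi i hi.1, Function.update_of_ne hi.1, hwb i hi.2]
    · intro i hi
      rcases Finset.mem_insert.1 hi with rfl | hi
      · have h1 : b'' i = (f i)⁻¹ • (l - ∑ a ∈ S, f a • b' a) := by
          rw [eq_inv_smul_iff₀ hf0, hb0]
          apply b'.ext_elem
          intro a
          have h2 : ∀ a, b'.repr (∑ a ∈ S, f a • b' a) a = if a ∈ S then f a else 0 := by
            intro a
            rw [map_sum, Finsupp.finsetSum_apply]
            simp [Finsupp.single_apply]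
          rw [map_sub, Finsupp.sub_apply, h2, map_smul, Finsupp.smul_apply, map_add,
            Finsupp.add_apply, hu, ← hf, smul_eq_mul]
          by_cases ha : a ∈ S
          · simp [r, ha, Finsupp.single_apply, (hnin a ha).symm]
          · by_cases hai : a = i
            · subst hai; simp [r, ha]
            · simp [r, ha, hai, Finsupp.single_apply, Ne.symm hai]
              field_simp
        rw [h1]
        refine Submodule.smul_mem _ _ (Submodule.sub_mem _ ?_ ?_)
        · exact Submodule.subset_span ⟨i, by simp, by simp⟩
        · exact Submodule.sum_mem _ fun a ha => Submodule.smul_mem _ _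
            (Submodule.span_mono hwimg (hspan a ha))
      · rw [hbi i (hnin i hi)]
        exact Submodule.span_mono hwimg (hspan i hi)
    · rw [hDw, map_mul, Finset.prod_insert hi0S, Function.update_self]
      have h1 : ∏ i ∈ S, vK (Function.update π i0 q i : K) = ∏ i ∈ S, vK (π i : K) :=
        Finset.prod_congr rfl fun i hi => by rw [Function.update_of_ne (hnin i hi)]
      rw [h1]
      calc _ = (t * vK (q : K)) * (t ^ k * (∏ i ∈ S, vK (π i : K)) * vK (D b)) := by ring
        _ ≤ _ := by gcongr

lemma mul_sSup_le_aux (a y : ℝ≥0) (S : Set ℝ≥0) (hS : S.Nonempty) (h : ∀ s ∈ S, a * s ≤ y) :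
    a * sSup S ≤ y := by
  rcases eq_or_ne a 0 with rfl | ha
  · simp
  · rw [mul_comm, ← le_div_iff₀ (pos_iff_ne_zero.2 ha)]
    refine csSup_le hS fun s hs => ?_
    rw [le_div_iff₀ (pos_iff_ne_zero.2 ha), mul_comm]
    exact h s hs

lemma span_repr_le_one {n : ℕ} (b : Module.Basis (Fin n) K V) (v : V)
    (hv : v ∈ Submodule.span vK.integer (Set.range b)) : ∀ j, vK (b.repr v j) ≤ 1 := by
  induction hv using Submodule.span_induction with
  | mem x hx =>
    obtain ⟨k, rfl⟩ := hx
    intro j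
    rw [Module.Basis.repr_self, Finsupp.single_apply]
    split_ifs <;> simp
  | zero => simp
  | add x y _ _ hx hy =>
    intro j
    rw [map_add, Finsupp.add_apply]
    exact (vK.map_add _ _).trans (max_le (hx j) (hy j))
  | smul a x _ hx =>
    intro j
    have : a • x = (a : K) • x := rfl
    rw [this, map_smul, Finsupp.smul_apply, smul_eq_mul, map_mul]
    exact mul_le_one' a.2 (hx j)

lemma inter_spans {n : ℕ} (b : Module.Basis (Fin n) K V) (L : Submodule vK.integer V)
    (hL : Submodule.span K (L : Set V) = ⊤) :
    Submodule.span K ((L ⊓ Submodule.span vK.integer (Set.range b) :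
      Submodule vK.integer V) : Set V) = ⊤ := by
  rw [eq_top_iff, ← hL, Submodule.span_le]
  intro v hv
  obtain ⟨a, ha0, ha1, ha⟩ : ∃ a : K, a ≠ 0 ∧ vK a ≤ 1 ∧ ∀ i, vK (a * b.repr v i) ≤ 1 := by
    by_cases hsmall : ∀ i, vK (b.repr v i) ≤ 1
    · exact ⟨1, one_ne_zero, by simp, by simpa using hsmall⟩
    · push Not at hsmall
      obtain ⟨i1, hi1⟩ := hsmall
      obtain ⟨q, -, hq⟩ := Finset.exists_max_image Finset.univ (fun i => vK (b.repr v i))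
        ⟨i1, Finset.mem_univ _⟩
      have hq1 : 1 < vK (b.repr v q) := hi1.trans_le (hq i1 (Finset.mem_univ _))
      have hq0 : b.repr v q ≠ 0 := by rw [← vK.ne_zero_iff]; exact (zero_lt_one.trans hq1).ne'
      refine ⟨(b.repr v q)⁻¹, inv_ne_zero hq0, ?_, fun i => ?_⟩
      · rw [map_inv₀]; exact inv_le_one_of_one_le₀ hq1.le
      · rw [map_mul, map_inv₀, inv_mul_le_one₀ (zero_lt_one.trans hq1)]
        exact hq i (Finset.mem_univ _)
  have h1 : a • v ∈ L := L.smul_mem (⟨a, ha1⟩ : vK.integer) hv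
  have h2 : a • v ∈ Submodule.span vK.integer (Set.range b) := by
    rw [← b.sum_repr v, Finset.smul_sum]
    refine Submodule.sum_mem _ fun i _ => ?_
    rw [smul_smul]
    exact Submodule.smul_mem _ (⟨_, ha i⟩ : vK.integer) (Submodule.subset_span ⟨i, rfl⟩)
  have h3 : v = a⁻¹ • (a • v) := by rw [inv_smul_smul₀ ha0]
  rw [h3]
  exact Submodule.smul_mem _ _ (Submodule.subset_span ⟨h1, h2⟩)

lemma content_le {n : ℕ} (B : Module.Basis (Fin n) K V) (M L : Submodule vK.integer V)
    (hL : Submodule.span K (L : Set V) = ⊤) (m : Fin n → V) (hm : ∀ i, m i ∈ M)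
    (hm0 : B.det m ≠ 0) (t : ℝ≥0) (ht0 : 0 < t) (ht : t < 1) :
    ∃ w : Fin n → V, (∀ i, w i ∈ L) ∧
      t ^ n * (content vK.integer (fun a => vK (a : K)) (M ⧸ Submodule.comap M.subtype L)
        * vK (B.det m)) ≤ vK (B.det w) := by
  obtain ⟨hli, hsp⟩ := B.is_basis_iff_det.2 (isUnit_iff_ne_zero.2 hm0)
  let b := Module.Basis.mk hli hsp.ge
  have hb : (b : Fin n → V) = m := by simp [b]
  set M0 := Submodule.span vK.integer (Set.range b) with hM0
  have hM0M : M0 ≤ M := by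
    rw [hM0, Submodule.span_le, hb]
    rintro _ ⟨i, rfl⟩; exact hm i
  obtain ⟨S, b', w, π, hS, h1, h2, h3, h4, -, -, h5⟩ := smith_step vK B.det M0 (L ⊓ M0) b
    (fun i => Submodule.subset_span ⟨i, rfl⟩)
    (fun v hv => span_repr_le_one vK b v hv.2) (inter_spans vK b L hL) t ht0 ht n le_rfl
  have hSu : S = Finset.univ := by
    rw [← Finset.card_eq_iff_eq_univ, hS, Fintype.card_fin]
  subst hSu
  refine ⟨w, fun i => (h4 i (Finset.mem_univ _)).1, le_trans ?_ h5⟩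
  rw [hb, mul_assoc]
  gcongr
  -- now the content bound
  apply csInf_le (OrderBot.bddBelow _)
  let bM : Fin n → M := fun i => ⟨b' i, hM0M (h1 i)⟩
  let ψ0 : (Fin n → vK.integer) →ₗ[vK.integer] M := Fintype.linearCombination vK.integer bM
  let ψ : (Fin n → vK.integer) →ₗ[vK.integer] (M ⧸ Submodule.comap M.subtype L) :=
    (Submodule.mkQ _) ∘ₗ ψ0
  let χ : (Fin n → vK.integer) →ₗ[vK.integer] ((i : Fin n) → vK.integer ⧸ Ideal.span {π i}) :=
    LinearMap.pi fun i => (Submodule.mkQ (Ideal.span {π i})) ∘ₗ LinearMap.proj i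
  have hχ : Function.Surjective χ := by
    intro y
    choose z hz using fun i => Submodule.mkQ_surjective (Ideal.span {π i}) (y i)
    exact ⟨z, funext hz⟩
  have hker : LinearMap.ker ψ ≤ LinearMap.ker χ := by
    intro c hc
    have hc1 : (ψ0 c : V) ∈ L := by
      have : Submodule.mkQ (Submodule.comap M.subtype L) (ψ0 c) = 0 := hc
      rw [Submodule.mkQ_apply, Submodule.Quotient.mk_eq_zero] at this
      exact this
    have hc2 : (ψ0 c : V) = ∑ i, (c i : K) • b' i := by
      simp only [ψ0, Fintype.linearCombination_apply, Submodule.coe_sum]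
      rfl
    have hc3 : (ψ0 c : V) ∈ M0 := by
      rw [hc2]
      exact Submodule.sum_mem _ fun i _ => M0.smul_mem (c i) (h1 i)
    have hc4 : ∀ i, vK (c i : K) ≤ vK (π i : K) := by
      intro i
      have := h3 _ ⟨hc1, hc3⟩ i (Finset.mem_univ _)
      rw [hc2, b'.repr_sum_self] at this
      exact this
    rw [LinearMap.mem_ker]
    funext i
    change Submodule.mkQ (Ideal.span {π i}) (c i) = 0
    rw [Submodule.mkQ_apply, Submodule.Quotient.mk_eq_zero, Ideal.mem_span_singleton]
    by_cases hp : (π i : K) = 0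
    · have h0 := hc4 i
      rw [hp, map_zero] at h0
      have h0' : (c i : K) = 0 := by
        rw [← vK.zero_iff]; exact le_antisymm h0 zero_le
      have : c i = 0 := Subtype.ext h0'
      rw [this]; exact dvd_zero _
    · refine ⟨⟨(c i : K) / π i, ?_⟩, Subtype.ext ?_⟩
      · change vK _ ≤ 1
        rw [map_div₀]
        exact div_le_one_of_le₀ (hc4 i) zero_le
      · exact (mul_div_cancel₀ _ hp).symm
  let χ' : LinearMap.range ψ →ₗ[vK.integer] ((i : Fin n) → vK.integer ⧸ Ideal.span {π i}) :=
    ((LinearMap.ker ψ).liftQ χ hker) ∘ₗ ψ.quotKerEquivRange.symm.toLinearMap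
  have hχ' : Function.Surjective χ' := by
    intro y
    obtain ⟨z, hz⟩ := hχ y
    refine ⟨ψ.quotKerEquivRange (Submodule.Quotient.mk z), ?_⟩
    simp [χ', hz]
  exact ⟨LinearMap.range ψ, LinearMap.ker χ', n, π, ⟨χ'.quotKerEquivOfSurjective hχ'⟩, rfl⟩

lemma le_content_elem {n : ℕ} (B : Module.Basis (Fin n) K V) (M L : Submodule vK.integer V)
    (hLM : L ≤ M)
    (N₁ : Submodule vK.integer (M ⧸ Submodule.comap M.subtype L))
    (N₂ : Submodule vK.integer N₁) (k : ℕ) (π : Fin k → vK.integer)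
    (E : (N₁ ⧸ N₂) ≃ₗ[vK.integer] ((i : Fin k) → vK.integer ⧸ Ideal.span {π i}))
    (l : Fin n → V) (hl : ∀ i, l i ∈ L) :
    ∃ m : Fin n → V, (∀ i, m i ∈ M) ∧
      vK (B.det l) ≤ (∏ i, vK (π i : K)) * vK (B.det m) := by
  let q := Submodule.mkQ (Submodule.comap M.subtype L)
  let Q : Submodule vK.integer M := N₁.comap q
  let g : Q →ₗ[vK.integer] N₁ := (q ∘ₗ Q.subtype).codRestrict N₁ (fun x => x.2)
  have hg : Function.Surjective g := by
    rintro ⟨y, hy⟩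
    obtain ⟨x, rfl⟩ := Submodule.mkQ_surjective _ y
    exact ⟨⟨x, hy⟩, rfl⟩
  let φ := E.toLinearMap ∘ₗ N₂.mkQ ∘ₗ g
  have hφ : Function.Surjective φ :=
    E.surjective.comp ((Submodule.mkQ_surjective _).comp hg)
  let j : Q →ₗ[vK.integer] V := M.subtype ∘ₗ Q.subtype
  have hj : Function.Injective j := M.injective_subtype.comp Q.injective_subtype
  have hq0 : ∀ i, q ⟨l i, hLM (hl i)⟩ = 0 := by
    intro i
    rw [Submodule.mkQ_apply, Submodule.Quotient.mk_eq_zero]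
    exact hl i
  let x : Fin n → Q := fun i => ⟨⟨l i, hLM (hl i)⟩, by
    change q _ ∈ N₁
    rw [hq0]; exact N₁.zero_mem⟩
  have hgx : ∀ i, g (x i) = 0 := fun i => Subtype.ext (hq0 i)
  obtain ⟨y, hy⟩ := cyclic_chain vK B j hj π φ hφ Finset.univ x (by
    intro a i _
    change E (N₂.mkQ (g (x a))) i = 0
    rw [hgx, map_zero, map_zero]; rfl)
  exact ⟨j ∘ y, fun i => (y i : M).2, hy⟩

end helpers

/-- For two bounded semilattices `L ⊆ M` of a finite-dimensional vector space `V` over a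
real-valued field `K`, the index equals the inverse of the content: `[M : L] = cont(M/L)⁻¹`. -/
theorem semilatticeIndex_eq_inv_content
    {K V : Type*} [Field K] [AddCommGroup V] [Module K V] [FiniteDimensional K V]
    (vK : Valuation K ℝ≥0)
    (M L : Submodule ↥vK.integer V) (hLM : L ≤ M)
    (hM : IsBoundedSemilattice vK M) (hL : IsBoundedSemilattice vK L) :
    semilatticeIndex vK (Module.finrank K V) M L
      = (content ↥vK.integer (fun a => vK ↑a)
          (↥M ⧸ Submodule.comap M.subtype L))⁻¹ := by
  classical
  obtain ⟨B, hB⟩ := exists_good_basis vK M hM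
  set C := content ↥vK.integer (fun a => vK ↑a) (↥M ⧸ Submodule.comap M.subtype L) with hC
  obtain ⟨l0, hl0, hl0'⟩ := exists_det_ne vK B L hL.1
  have hl0v : 0 < vK (B.det l0) := by simpa [pos_iff_ne_zero] using hl0'
  let A : Submodule vK.integer V → Set ℝ≥0 := fun P =>
    {r | ∃ m : Fin (Module.finrank K V) → V, (∀ i, m i ∈ P) ∧ vK (B.det m) = r}
  have hbM : BddAbove (A M) := ⟨1, by rintro _ ⟨m, hm, rfl⟩; exact hB m hm⟩
  have hsub : A L ⊆ A M := by rintro _ ⟨m, hm, rfl⟩; exact ⟨m, fun i => hLM (hm i), rfl⟩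
  have hbL : BddAbove (A L) := hbM.mono hsub
  have hneL : (A L).Nonempty := ⟨_, l0, hl0, rfl⟩
  have hneM : (A M).Nonempty := hneL.mono hsub
  set dL := sSup (A L) with hdL
  set dM := sSup (A M) with hdM
  have hleL : ∀ m : Fin (Module.finrank K V) → V, (∀ i, m i ∈ L) → vK (B.det m) ≤ dL :=
    fun m hm => le_csSup hbL ⟨m, hm, rfl⟩
  have hleM : ∀ m : Fin (Module.finrank K V) → V, (∀ i, m i ∈ M) → vK (B.det m) ≤ dM :=
    fun m hm => le_csSup hbM ⟨m, hm, rfl⟩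
  have hdLpos : 0 < dL := hl0v.trans_le (hleL l0 hl0)
  have hdMpos : 0 < dM := hl0v.trans_le (hleM l0 fun i => hLM (hl0 i))
  -- limiting principle
  have hlim : ∀ (N : ℕ) (x y : ℝ≥0), (∀ t : ℝ≥0, 0 < t → t < 1 → t ^ N * x ≤ y) → x ≤ y := by
    intro N x y h
    have hcont : Filter.Tendsto (fun t : ℝ≥0 => t ^ N * x) (nhdsWithin 1 (Set.Iio 1))
        (nhds (1 ^ N * x)) := by
      apply Filter.Tendsto.mono_left _ nhdsWithin_le_nhds
      exact ((continuous_id.pow N).mul continuous_const).tendsto 1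
    rw [one_pow, one_mul] at hcont
    have : (nhdsWithin (1 : ℝ≥0) (Set.Iio 1)).NeBot := nhdsLT_neBot_of_exists_lt ⟨0, zero_lt_one⟩
    refine le_of_tendsto hcont ?_
    have h0 : ∀ᶠ t : ℝ≥0 in nhdsWithin 1 (Set.Iio 1), 0 < t :=
      nhdsWithin_le_nhds (lt_mem_nhds zero_lt_one)
    filter_upwards [h0, self_mem_nhdsWithin] with t ht0 ht1
    exact h t ht0 ht1
  -- content
  have hc1 : C * dM ≤ dL := by
    apply hlim (Module.finrank K V)
    intro t ht0 ht1
    rw [← mul_assoc, hdM]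
    apply mul_sSup_le_aux _ _ _ hneM
    rintro _ ⟨m, hm, rfl⟩
    by_cases h0 : B.det m = 0
    · simp [h0]
    · obtain ⟨w, hw, h⟩ := content_le vK B M L hL.1 m hm h0 t ht0 ht1
      exact (by simpa only [mul_assoc] using h.trans (hleL w hw))
  have hc2 : dL ≤ C * dM := by
    rw [← div_le_iff₀ hdMpos]
    apply le_csInf
    · have : Subsingleton ((⊥ : Submodule vK.integer (↥M ⧸ Submodule.comap M.subtype L)) ⧸
          (⊥ : Submodule vK.integer
            (⊥ : Submodule vK.integer (↥M ⧸ Submodule.comap M.subtype L)))) :=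
        (Submodule.mkQ_surjective _).subsingleton
      exact ⟨_, ⊥, ⊥, 0, fun _ => 0, ⟨⟨0, 0, fun _ => Subsingleton.elim _ _,
        fun _ => Subsingleton.elim _ _⟩⟩, rfl⟩
    · rintro _ ⟨N₁, N₂, k, π, ⟨E⟩, rfl⟩
      rw [div_le_iff₀ hdMpos]
      apply csSup_le hneL
      rintro _ ⟨l, hl, rfl⟩
      obtain ⟨m, hm, h⟩ := le_content_elem vK B M L hLM N₁ N₂ k π E l hl
      exact h.trans (mul_le_mul_right (hleM m hm) _)
  have hCeq : C * dM = dL := le_antisymm hc1 hc2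
  have hgoal : C⁻¹ = dM / dL := by
    have hCpos : C ≠ 0 := by rintro h; rw [h, zero_mul] at hCeq; exact hdLpos.ne hCeq
    rw [← hCeq]
    field_simp
  rw [hgoal]
  unfold semilatticeIndex
  simp_rw [smul_det_iff vK B M L]
  have hub : ∀ r ∈ {r | ∃ π : K, vK π = r ∧ ∀ l : Fin (Module.finrank K V) → V, (∀ i, l i ∈ L) →
      ∃ m : Fin (Module.finrank K V) → V, (∀ i, m i ∈ M) ∧ vK π * vK (B.det l) ≤ vK (B.det m)}, r ≤ dM / dL := by
    rintro _ ⟨p, rfl, hp⟩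
    rw [le_div_iff₀ hdLpos, hdL]
    apply mul_sSup_le_aux _ _ _ hneL
    rintro _ ⟨l, hl, rfl⟩
    obtain ⟨m, hm, h⟩ := hp l hl
    exact h.trans (hleM m hm)
  apply le_antisymm
  · refine csSup_le ⟨0, 0, map_zero _, fun l hl => ⟨l, fun i => hLM (hl i), by simp⟩⟩ hub
  · rw [div_le_iff₀ hdLpos]
    apply hlim 2
    intro t ht0 ht1
    obtain ⟨_, ⟨m, hm, rfl⟩, h1⟩ := exists_lt_of_lt_csSup hneM
      (show t * dM < sSup (A M) from mul_lt_of_lt_one_left hdMpos ht1)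
    obtain ⟨_, ⟨l, hl, rfl⟩, p, hp0, hpx, hpA⟩ := ex_pi vK
      {x : K | ∃ l : Fin (Module.finrank K V) → V, (∀ i, l i ∈ L) ∧ B.det l = x} 1
      (by rintro _ ⟨l, hl, rfl⟩; exact hB l fun i => hLM (hl i))
      ⟨_, ⟨l0, hl0, rfl⟩, hl0'⟩ t ht1
    have hpv : 0 < vK p := by simpa [pos_iff_ne_zero] using hp0
    have hmem : vK (B.det m / p) ≤ sSup {r | ∃ π : K, vK π = r ∧ ∀ l : Fin (Module.finrank K V) → V,
        (∀ i, l i ∈ L) → ∃ m : Fin (Module.finrank K V) → V, (∀ i, m i ∈ M) ∧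
          vK π * vK (B.det l) ≤ vK (B.det m)} := by
      refine le_csSup ⟨_, hub⟩ ⟨_, rfl, fun l' hl' => ⟨m, hm, ?_⟩⟩
      rw [map_div₀, div_mul_eq_mul_div, div_le_iff₀ hpv]
      gcongr
      exact hpA _ ⟨l', hl', rfl⟩
    calc t ^ 2 * dM = t * (t * dM) := by ring
      _ ≤ t * vK (B.det m) := by gcongr
      _ = vK (B.det m / p) * (t * vK p) := by
          rw [map_div₀]; field_simp
      _ ≤ _ := mul_le_mul' hmem (hpx.trans (hleL l hl))
end

section
/- Let K be a real-valued field with ring of integers K°. Every finitely presented K°-module M is isomorphic to a finite direct sum ⊕_{i=1}^n K°/π_i K° with each summand nonzero, i.e., with π_i ∈ K° satisfying 1 > |π₁| ≥ |π₂| ≥ ⋯ ≥ |πₙ| ≥ 0. Moreover, the sequence of real numbers (|π₁|, …, |πₙ|) is uniquely determined by M: if M ≅ ⊕_{i=1}^n K°/π_i K° ≅ ⊕_{j=1}^m K°/π'_j K° with both sequences of absolute values decreasing and < 1, then n = m and |π_i| = |π'_i| for all i. -/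
open scoped NNReal

set_option synthInstance.maxHeartbeats 1000000
set_option maxHeartbeats 2000000

theorem aux_exists_min {R : Type*} [CommRing R] [IsDomain R] [ValuationRing R]
    {α : Type*} (s : Finset α) (hs : s.Nonempty) (f : α → R) :
    ∃ a ∈ s, ∀ b ∈ s, f a ∣ f b := by
  classical
  induction hs using Finset.Nonempty.cons_induction with
  | singleton a => exact ⟨a, by simp, by simp⟩
  | cons a s h hs ih =>
    obtain ⟨c, hc, hcs⟩ := ih
    rcases ValuationRing.dvd_total (f a) (f c) with h1 | h1
    · refine ⟨a, by simp, fun b hb => ?_⟩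
      rcases Finset.mem_cons.1 hb with rfl | hb
      · exact dvd_rfl
      · exact h1.trans (hcs b hb)
    · refine ⟨c, by simp [hc], fun b hb => ?_⟩
      rcases Finset.mem_cons.1 hb with rfl | hb
      · exact h1
      · exact hcs b hb

theorem aux_smith {R : Type*} [CommRing R] [IsDomain R] [ValuationRing R] (n : ℕ) :
    ∀ N : Submodule R (Fin n → R), N.FG →
      ∃ (g : (Fin n → R) →ₗ[R] (Fin n → R)) (d : Fin n → R), Function.Surjective g ∧
        ∀ x, x ∈ N ↔ ∀ i, d i ∣ g x i := by
  classical
  induction n with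
  | zero =>
    intro N _
    refine ⟨LinearMap.id, 0, Function.surjective_id, fun x => ?_⟩
    rw [Subsingleton.elim x 0]
    exact ⟨fun _ i => i.elim0, fun _ => N.zero_mem⟩
  | succ n ih =>
    intro N hN
    obtain ⟨S, hS⟩ := hN
    by_cases hSe : S.Nonempty
    swap
    · rw [Finset.not_nonempty_iff_eq_empty] at hSe
      subst hSe
      refine ⟨LinearMap.id, 0, Function.surjective_id, fun x => ?_⟩
      rw [← hS]
      simp [funext_iff]
    obtain ⟨⟨s0, i0⟩, hs0, hmin⟩ := aux_exists_min (S ×ˢ (Finset.univ : Finset (Fin (n+1))))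
      (hSe.product Finset.univ_nonempty) (fun p => p.1 p.2)
    replace hs0 : s0 ∈ S := (Finset.mem_product.1 hs0).1
    replace hmin : ∀ s ∈ S, ∀ i, s0 i0 ∣ s i := fun s hs i =>
      hmin (s, i) (Finset.mem_product.2 ⟨hs, Finset.mem_univ _⟩)
    have hs0N : s0 ∈ N := hS ▸ Submodule.subset_span hs0
    have hdvd : ∀ x ∈ N, ∀ i, s0 i0 ∣ x i := by
      intro x hx i
      rw [← hS] at hx
      induction hx using Submodule.span_induction with
      | mem x hx => exact hmin x hx i
      | zero => simp
      | add x y _ _ hx hy => exact dvd_add hx hy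
      | smul a x _ hx => exact hx.mul_left a
    obtain ⟨e, he1, he⟩ : ∃ e : Fin (n+1) → R, e i0 = 1 ∧ s0 = s0 i0 • e := by
      by_cases h0 : s0 i0 = 0
      · refine ⟨fun _ => 1, rfl, ?_⟩
        ext i
        have := hmin s0 hs0 i
        rw [h0, zero_dvd_iff] at this
        simp [this, h0]
      · choose e he using hmin s0 hs0
        refine ⟨e, ?_, funext he⟩
        have := he i0
        exact mul_left_cancel₀ h0 (by rw [← this, mul_one])
    set a := s0 i0 with ha
    let φ : (Fin (n+1) → R) →ₗ[R] (Fin n → R) :=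
      { toFun := fun x j => x (i0.succAbove j) - x i0 * e (i0.succAbove j)
        map_add' := by intro x y; ext j; simp; ring
        map_smul' := by intro c x; ext j; simp; ring }
    have hφ : ∀ x j, φ x j = x (i0.succAbove j) - x i0 * e (i0.succAbove j) := fun _ _ => rfl
    obtain ⟨g', d', hg', hd'⟩ := ih (N.map φ) (Submodule.FG.map φ ⟨S, hS⟩)
    let g : (Fin (n+1) → R) →ₗ[R] (Fin (n+1) → R) :=
      LinearMap.pi (Fin.cons (LinearMap.proj i0) (fun j => LinearMap.proj j ∘ₗ g' ∘ₗ φ))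
    have hg0 : ∀ x, g x 0 = x i0 := fun x => rfl
    have hgs : ∀ x j, g x (Fin.succ j) = g' (φ x) j := fun x j => rfl
    refine ⟨g, Fin.cons a d', ?_, ?_⟩
    · intro y
      obtain ⟨x', hx'⟩ := hg' (fun j => y j.succ)
      refine ⟨i0.insertNth 0 x' + y 0 • e, ?_⟩
      have : φ (i0.insertNth 0 x' + y 0 • e) = x' := by
        ext j
        simp [hφ, he1]
      ext i
      refine Fin.cases ?_ (fun j => ?_) i
      · simp [hg0, he1]
      · rw [hgs, this, hx']
    · intro x
      rw [Fin.forall_fin_succ]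
      simp only [hg0, hgs, Fin.cons_zero, Fin.cons_succ]
      rw [← hd']
      constructor
      · intro hx
        exact ⟨hdvd x hx i0, Submodule.mem_map_of_mem hx⟩
      · rintro ⟨h1, y, hy, hyx⟩
        have hz : x - y = (x - y) i0 • e := by
          ext i
          rcases Fin.eq_self_or_eq_succAbove i0 i with rfl | ⟨j, rfl⟩
          · simp [he1]
          · have := congrFun hyx j
            simp only [hφ] at this
            simp only [Pi.sub_apply, Pi.smul_apply, smul_eq_mul]
            linear_combination -this
        obtain ⟨c, hc⟩ : a ∣ (x - y) i0 := dvd_sub h1 (hdvd y hy i0)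
        have : x - y ∈ N := by
          rw [hz, hc, mul_comm, mul_smul, ← he]
          exact N.smul_mem _ hs0N
        simpa using N.add_mem this hy

theorem aux_count {R : Type*} [CommRing R] [IsLocalRing R] {ι κ : Type*} [Fintype ι] [Fintype κ]
    (p : ι → R) (q : κ → R)
    (f : ((i : ι) → R ⧸ Ideal.span {p i}) →ₗ[R] ((j : κ) → R ⧸ Ideal.span {q j}))
    (hf : Function.Surjective f) (r : R) :
    Nat.card {j // ¬ q j ∣ r} ≤ Nat.card {i // ¬ p i ∣ r} := by
  classical
  have hb : ∀ i j, ∃ b : R, Ideal.Quotient.mk (Ideal.span {q j}) b = f (Pi.single i 1) j :=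
    fun i j => Ideal.Quotient.mk_surjective _
  choose b hb using hb
  have hrep : ∀ (x : ι → R) j, f (fun i => Ideal.Quotient.mk _ (x i)) j
      = Ideal.Quotient.mk (Ideal.span {q j}) (∑ i, x i * b i j) := by
    intro x j
    have : (fun i => Ideal.Quotient.mk (Ideal.span {p i}) (x i))
        = ∑ i, x i • (Pi.single i 1 : (i : ι) → R ⧸ Ideal.span {p i}) := by
      ext k
      rw [Finset.sum_apply, Finset.sum_eq_single k]
      · rw [Pi.smul_apply, Pi.single_eq_same, Algebra.smul_def, mul_one]; rfl
      · intro i _ hik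
        rw [Pi.smul_apply, Pi.single_eq_of_ne (Ne.symm hik), smul_zero]
      · simp
    rw [this, map_sum, Finset.sum_apply, map_sum]
    refine Finset.sum_congr rfl fun i _ => ?_
    rw [map_smul, Pi.smul_apply, ← hb, map_mul, Algebra.smul_def]; rfl
  have h1 : ∀ y : κ → R, ∃ x : ι → R, ∀ j, q j ∣ y j - ∑ i, x i * b i j := by
    intro y
    obtain ⟨x, hx⟩ := hf (fun j => Ideal.Quotient.mk _ (y j))
    choose x' hx' using fun i => Ideal.Quotient.mk_surjective (x i)
    refine ⟨x', fun j => ?_⟩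
    have := hrep x' j
    simp only [hx'] at this
    rw [hx] at this
    rw [← Ideal.mem_span_singleton]
    exact (Ideal.Quotient.eq).1 this
  have h2 : ∀ i j, q j ∣ p i * b i j := by
    intro i j
    have := hrep (Pi.single i (p i)) j
    have h0 : (fun k => Ideal.Quotient.mk (Ideal.span {p k}) ((Pi.single i (p i) : ι → R) k)) = 0 := by
      ext k
      by_cases h : k = i
      · subst h
        simp only [Pi.single_eq_same, Pi.zero_apply]
        exact Ideal.Quotient.eq_zero_iff_mem.2 (Ideal.mem_span_singleton_self _)
      · simp [Pi.single_eq_of_ne h]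
    rw [h0, map_zero, Finset.sum_eq_single i] at this
    · rw [← Ideal.mem_span_singleton]
      simpa using Ideal.Quotient.eq_zero_iff_mem.1 this.symm
    · intro k _ hk
      rw [Pi.single_eq_of_ne hk, zero_mul]
    · simp
  let k := IsLocalRing.ResidueField R
  let A : {i // ¬ p i ∣ r} → {j // ¬ q j ∣ r} → k := fun i j => IsLocalRing.residue R (b i j)
  have hspan : ⊤ ≤ Submodule.span k (Set.range A) := by
    intro y _
    choose y' hy' using fun j => IsLocalRing.residue_surjective (R := R) (y j)
    obtain ⟨x, hx⟩ := h1 (fun j => if h : ¬ q j ∣ r then y' ⟨j, h⟩ else 0)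
    have : y = ∑ i : {i // ¬ p i ∣ r}, IsLocalRing.residue R (x i) • A i := by
      ext ⟨j, hj⟩
      have hxj := hx j
      rw [dif_pos hj] at hxj
      rw [Finset.sum_apply, ← hy', ← sub_eq_zero]
      simp only [Pi.smul_apply, A, smul_eq_mul, ← map_mul, ← map_sum, ← map_sub]
      rw [IsLocalRing.residue_eq_zero_iff, IsLocalRing.mem_maximalIdeal, mem_nonunits_iff]
      intro hu
      apply hj
      rw [← hu.dvd_mul_right]
      have hsplit : ∑ i, x i * b i j = ∑ i : {i // ¬ p i ∣ r}, x i * b i j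
          + ∑ i : {i // ¬ ¬ p i ∣ r}, x i * b i j :=
        (Fintype.sum_subtype_add_sum_subtype (fun i => ¬ p i ∣ r) (fun i => x i * b i j)).symm
      rw [hsplit] at hxj
      have h3 : q j ∣ r * ∑ i : {i // ¬ ¬ p i ∣ r}, x i * b i j := by
        rw [Finset.mul_sum]
        refine Finset.dvd_sum fun i _ => ?_
        obtain ⟨c, hc⟩ := not_not.1 i.2
        obtain ⟨d, hd⟩ := h2 i j
        exact ⟨c * x i * d, by linear_combination (c * x i) * hd + (x i * b i j) * hc⟩
      have h4 := dvd_add (hxj.mul_left r) h3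
      convert h4 using 1
      ring
    rw [this]
    exact Submodule.sum_mem _ fun i _ => Submodule.smul_mem _ _ (Submodule.subset_span ⟨i, rfl⟩)
  have := finrank_range_le_card (R := k) A
  rw [Set.finrank, top_le_iff.1 hspan, finrank_top, Module.finrank_fintype_fun_eq_card] at this
  simpa [Nat.card_eq_fintype_card] using this

theorem aux_ideal {R : Type*} [CommRing R] {n : ℕ} (p : Fin n → R)
    (hp : ∀ i j, i ≤ j → p i ∣ p j) (r : R) (i : Fin n) :
    p i ∣ r ↔ Nat.card {j // ¬ p j ∣ r} + i < n := by
  classical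
  rw [Nat.card_eq_fintype_card, Fintype.card_subtype]
  constructor
  · intro h
    have : (Finset.univ.filter fun j => ¬ p j ∣ r) ⊆ Finset.Ioi i := by
      intro j hj
      simp only [Finset.mem_filter, Finset.mem_univ, true_and] at hj
      rw [Finset.mem_Ioi]
      by_contra hc
      exact hj ((hp j i (not_lt.1 hc)).trans h)
    have := Finset.card_le_card this
    rw [Fin.card_Ioi] at this
    omega
  · intro h
    by_contra hc
    have : Finset.Ici i ⊆ (Finset.univ.filter fun j => ¬ p j ∣ r) := by
      intro j hj
      simp only [Finset.mem_filter, Finset.mem_univ, true_and]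
      exact fun h' => hc ((hp i j (Finset.mem_Ici.1 hj)).trans h')
    have := Finset.card_le_card this
    rw [Fin.card_Ici] at this
    omega

theorem aux_card_one {R : Type*} [CommRing R] {n : ℕ} (p : Fin n → R)
    (hp : ∀ i, ¬ IsUnit (p i)) : Nat.card {j // ¬ p j ∣ 1} = n := by
  have : ∀ j, ¬ p j ∣ 1 := fun j h => hp j (isUnit_of_dvd_one h)
  simp [this, Nat.card_eq_fintype_card]

/-- Structure theorem for finitely presented modules over the ring of integers `K°` of a
real-valued field `K`: every finitely presented `K°`-module `M` is isomorphic to a direct sum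
`⊕ᵢ K°/πᵢK°` with nonzero summands (`|πᵢ| < 1`, allowing `πᵢ = 0` for free summands), where the
absolute values `|πᵢ|` are arranged in decreasing order; moreover, the sequence
`(|π₁|, …, |πₙ|)` is uniquely determined by `M`. -/
theorem finitePresentation_structure_over_integer_ring
    {K : Type*} [Field K] (vK : Valuation K ℝ≥0)
    (M : Type*) [AddCommGroup M] [Module ↥vK.integer M]
    [Module.FinitePresentation ↥vK.integer M] :
    -- existence of a decomposition
    (∃ (n : ℕ) (π : Fin n → ↥vK.integer),
      (∀ i, vK ↑(π i) < 1) ∧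
      (∀ i j : Fin n, i ≤ j → vK ↑(π j) ≤ vK ↑(π i)) ∧
      Nonempty (M ≃ₗ[↥vK.integer]
        ((i : Fin n) → ↥vK.integer ⧸ Ideal.span {π i}))) ∧
    -- uniqueness of the sequence of absolute values
    (∀ (n m : ℕ) (π : Fin n → ↥vK.integer) (π' : Fin m → ↥vK.integer),
      (∀ i, vK ↑(π i) < 1) → (∀ i j : Fin n, i ≤ j → vK ↑(π j) ≤ vK ↑(π i)) →
      (∀ i, vK ↑(π' i) < 1) → (∀ i j : Fin m, i ≤ j → vK ↑(π' j) ≤ vK ↑(π' i)) →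
      Nonempty (M ≃ₗ[↥vK.integer] ((i : Fin n) → ↥vK.integer ⧸ Ideal.span {π i})) →
      Nonempty (M ≃ₗ[↥vK.integer] ((i : Fin m) → ↥vK.integer ⧸ Ideal.span {π' i})) →
      n = m ∧ ∀ (i : Fin n) (j : Fin m), (i : ℕ) = (j : ℕ) → vK ↑(π i) = vK ↑(π' j)) := by
  classical
  have hint := Valuation.integer.integers vK
  have : ValuationRing ↥vK.integer := ValuationRing.of_integers vK hint
  have hdvd : ∀ x y : ↥vK.integer, x ∣ y ↔ vK (y : K) ≤ vK (x : K) := fun x y =>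
    ⟨fun h => hint.le_of_dvd h, fun h => hint.dvd_of_le h⟩
  have hunit : ∀ x : ↥vK.integer, vK (x : K) < 1 ↔ ¬ IsUnit x := by
    intro x
    rw [hint.isUnit_iff_valuation_eq_one]
    exact ⟨fun h => h.ne, fun h => lt_of_le_of_ne x.2 h⟩
  refine ⟨?_, ?_⟩
  · obtain ⟨n, f, hf, hker⟩ : ∃ (n : ℕ) (f : (Fin n → ↥vK.integer) →ₗ[↥vK.integer] M),
        Function.Surjective f ∧ (LinearMap.ker f).FG := by
      obtain ⟨n, f, hf⟩ := Module.Finite.exists_fin' ↥vK.integer M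
      exact ⟨n, f, hf, Module.FinitePresentation.fg_ker f hf⟩
    obtain ⟨g, d, hg, hd⟩ := aux_smith n _ hker
    let T := {i : Fin n // vK (d i : K) < 1}
    let e0 : Fin (Fintype.card T) ≃ T := (Fintype.equivFin T).symm
    let w : Fin (Fintype.card T) → (ℝ≥0)ᵒᵈ := fun j => OrderDual.toDual (vK (d (e0 j).1 : K))
    let e : Fin (Fintype.card T) ≃ T := (Tuple.sort w).trans e0
    have hmono : Monotone (w ∘ Tuple.sort w) := Tuple.monotone_sort w
    refine ⟨Fintype.card T, fun j => d (e j).1, fun j => (e j).2, fun i j hij => hmono hij, ?_⟩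
    let F : (Fin n → ↥vK.integer) →ₗ[↥vK.integer]
        ((j : Fin (Fintype.card T)) → ↥vK.integer ⧸ Ideal.span {d (e j).1}) :=
      LinearMap.pi fun j => (Submodule.mkQ (Ideal.span {d (e j).1})) ∘ₗ LinearMap.proj (e j).1 ∘ₗ g
    have hF : Function.Surjective F := by
      intro y
      choose y' hy' using fun j => Submodule.mkQ_surjective _ (y j)
      obtain ⟨x, hx⟩ := hg (fun i => if h : vK (d i : K) < 1 then y' (e.symm ⟨i, h⟩) else 0)
      refine ⟨x, ?_⟩
      ext j
      have h1 : g x (e j).1 = y' j := by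
        rw [hx]
        simp only
        rw [dif_pos (e j).2]
        simp
      rw [← hy' j, ← h1]
      rfl
    have hk : LinearMap.ker F = LinearMap.ker f := by
      ext x
      rw [hd, LinearMap.mem_ker]
      have h1 : ∀ j, F x j = 0 ↔ d (e j).1 ∣ g x (e j).1 := by
        intro j
        rw [← Ideal.mem_span_singleton]
        exact Submodule.Quotient.mk_eq_zero _
      rw [funext_iff]
      constructor
      · intro h i
        by_cases hi : vK (d i : K) < 1
        · have := (h1 (e.symm ⟨i, hi⟩)).1 (h _)
          simpa using this
        · exact (not_not.1 (mt (hunit _).2 hi)).dvd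
      · intro h j
        exact (h1 j).2 (h _)
    exact ⟨(f.quotKerEquivOfSurjective hf).symm ≪≫ₗ Submodule.quotEquivOfEq _ _ hk.symm ≪≫ₗ
      F.quotKerEquivOfSurjective hF⟩
  · rintro n m π π' h1 h2 h1' h2' ⟨e⟩ ⟨e'⟩
    have hc : ∀ r, Nat.card {j // ¬ π j ∣ r} = Nat.card {j // ¬ π' j ∣ r} := fun r =>
      le_antisymm (aux_count π' π (e'.symm ≪≫ₗ e).toLinearMap (e'.symm ≪≫ₗ e).surjective r)
        (aux_count π π' (e.symm ≪≫ₗ e').toLinearMap (e.symm ≪≫ₗ e').surjective r)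
    have hnm : n = m := by
      have := hc 1
      rwa [aux_card_one _ fun i => (hunit _).1 (h1 i),
        aux_card_one _ fun i => (hunit _).1 (h1' i)] at this
    refine ⟨hnm, ?_⟩
    subst hnm
    intro i j hij
    obtain rfl := Fin.ext hij
    have key : ∀ r, π i ∣ r ↔ π' i ∣ r := fun r => by
      rw [aux_ideal π (fun i j h => (hdvd _ _).2 (h2 i j h)),
        aux_ideal π' (fun i j h => (hdvd _ _).2 (h2' i j h)), hc]
    exact le_antisymm ((hdvd _ _).1 ((key _).1 dvd_rfl)) ((hdvd _ _).1 ((key _).2 dvd_rfl))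
end
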